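/- Let F be a field of characteristic 2 and E = F(α) a simple quartic extension with normalized minimal polynomial f(X) = X⁴ + aX³ + bX² + cX + d of α and cubic resolvent f_C(X) = X³ + bX² + acX + (a²d + c²). Let φ be an anisotropic nonsingular quadratic form over F with dim φ = 6, trivial Arf invariant Δ(φ) = 0 ∈ F/℘(F), and Witt class in W_q(E/F). Then there exist 2-fold quadratic Pfister forms π_1, π_2, each of one of the types (a') ⟨⟨h,g]] with F(℘⁻¹(g)) ⊆ E, (b) ⟨⟨g,h]] with F(√g) ⊆ E, or (c) ⟨⟨f_C(e), d/e²]] with e ∈ F*, f_C(e) ≠ 0, and a scalar λ ∈ F* such that φ = λ(π_1 + π_2) in W_qF. -/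

import Mathlib

open QuadraticMap

variable (F : Type) [Field F]

/-- Quadratic forms on `Fin n → F`. -/
abbrev QF (n : ℕ) := QuadraticForm F (Fin n → F)

/-- The nonsingular binary quadratic form `[a,b] = a x² + x y + b y²`. -/
noncomputable def binQF (a b : F) : QF F 2 :=
  (Matrix.of ![![a, 1], ![0, b]]).toQuadraticMap'

/-- The totally singular diagonal quadratic form `⟨c₁, …, c_n⟩ = Σ cᵢ xᵢ²`. -/
noncomputable def diagQF {n : ℕ} (c : Fin n → F) : QF F n :=
  QuadraticMap.weightedSumSquares F c

/-- Orthogonal sum of a finite family of quadratic forms of the same dimension. -/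
noncomputable def oSumFam {k n : ℕ} (q : Fin k → QF F n) : QF F (k * n) :=
  (QuadraticMap.pi q).comp
    ((LinearEquiv.curry F F (Fin k) (Fin n)).toLinearMap.comp
      (LinearEquiv.funCongrLeft F F finProdFinEquiv).toLinearMap)

/-- Orthogonal sum of two quadratic forms. -/
noncomputable def oSum {n m : ℕ} (q₁ : QF F n) (q₂ : QF F m) : QF F (n + m) :=
  (QuadraticMap.prod q₁ q₂).comp
    ((LinearEquiv.sumArrowLequivProdArrow (Fin n) (Fin m) F F).toLinearMap.comp
      (LinearEquiv.funCongrLeft F F finSumFinEquiv).toLinearMap)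

section General
variable {M N : Type} [AddCommGroup M] [Module F M] [AddCommGroup N] [Module F N]

/-- Two quadratic forms are isometric if there is an isometry (isomorphism preserving the
form) between them. -/
def QIsometric (q₁ : QuadraticForm F M) (q₂ : QuadraticForm F N) : Prop :=
  Nonempty (QuadraticMap.IsometryEquiv q₁ q₂)

/-- `q₁` is dominated by `q₂` (written `q₁ ≺ q₂`) if there is an injective linear map `t`
with `q₁ x = q₂ (t x)` for all `x`. -/
def Dominates (q₁ : QuadraticForm F M) (q₂ : QuadraticForm F N) : Prop :=
  ∃ t : M →ₗ[F] N, Function.Injective t ∧ ∀ x, q₁ x = q₂ (t x)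

/-- A quadratic form is nonsingular if the radical of its polar form is trivial. -/
def Nonsingular (q : QuadraticForm F M) : Prop :=
  ∀ x, (∀ y, polar q x y = 0) → x = 0

/-- A quadratic form is totally singular if its polar form vanishes identically. -/
def TotallySingular (q : QuadraticForm F M) : Prop :=
  ∀ x y, polar q x y = 0

/-- A quadratic form is hyperbolic if it is isometric to an orthogonal sum of
hyperbolic planes `ℍ = [0,0]`. -/
def Hyperbolic (q : QuadraticForm F M) : Prop :=
  ∃ k : ℕ, QIsometric F q (oSumFam F fun _ : Fin k => binQF F 0 0)

/-- Witt equivalence: two quadratic forms are Witt equivalent iff they have isometric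
anisotropic parts, i.e. both are isometric to `i × ℍ ⊥ ρ ⊥ j × ⟨0⟩` for a common
anisotropic form `ρ`. -/
def WittEquiv (q₁ : QuadraticForm F M) (q₂ : QuadraticForm F N) : Prop :=
  ∃ (r : ℕ) (ρ : QF F r), ρ.Anisotropic ∧
    (∃ i j : ℕ, QIsometric F q₁
      (oSum F (oSum F (oSumFam F fun _ : Fin i => binQF F 0 0) ρ) (diagQF F (0 : Fin j → F)))) ∧
    (∃ i j : ℕ, QIsometric F q₂
      (oSum F (oSum F (oSumFam F fun _ : Fin i => binQF F 0 0) ρ) (diagQF F (0 : Fin j → F))))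

end General

/-- The Gram-type matrix of a quadratic form on `Fin n → F`: diagonal entries are the values
on basis vectors, above-diagonal entries the polar values. -/
noncomputable def qMat {n : ℕ} (q : QF F n) : Matrix (Fin n) (Fin n) F :=
  Matrix.of fun i j =>
    if i = j then q (Pi.single i 1)
    else if i < j then polar q (Pi.single i 1) (Pi.single j 1) else 0

/-- Scalar extension of a quadratic form along `F → E`. -/
noncomputable def extQF (E : Type) [CommRing E] [Algebra F E] {n : ℕ} (q : QF F n) :
    QuadraticForm E (Fin n → E) :=
  ((qMat F q).map (algebraMap F E)).toQuadraticMap'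

/-- Membership of the Witt class of `q` in the kernel `W_q(E/F)` of `W_qF → W_qE`:
the scalar extension of `q` is Witt equivalent to the zero form. -/
def InWqKernel (E : Type) [Field E] [Algebra F E] {n : ℕ} (q : QF F n) : Prop :=
  WittEquiv E (extQF F E q) (0 : QF E 0)

/-- The 2-fold quadratic Pfister form `⟨⟨g,h]] = ⟨1,g⟩_b ⊗ [1,h] = [1,h] ⊥ g[1,h]`. -/
noncomputable def pf2 (g h : F) : QF F 4 :=
  oSum F (binQF F 1 h) (g • binQF F 1 h)

/-- The 3-fold quadratic Pfister form `⟨⟨g₁,g₂,h]] = ⟨1,g₁⟩_b ⊗ ⟨1,g₂⟩_b ⊗ [1,h]`. -/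
noncomputable def pf3 (g₁ g₂ h : F) : QF F 8 :=
  oSum F (pf2 F g₂ h) (g₁ • pf2 F g₂ h)

/-- Orthogonal sum of a list of quadratic forms of varying dimensions. -/
noncomputable def listOSum : List (Σ n, QF F n) → Σ n, QF F n
  | [] => ⟨0, 0⟩
  | x :: L => ⟨x.1 + (listOSum L).1, oSum F x.2 (listOSum L).2⟩

/-- The cubic resolvent `f_C(X) = X³ + bX² + acX + (a²d + c²)` of
`f(X) = X⁴ + aX³ + bX² + cX + d`, evaluated at `e`. -/
def cubicResolvent (a b c d e : F) : F := e ^ 3 + b * e ^ 2 + a * c * e + (a ^ 2 * d + c ^ 2)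

/-- A 2-fold quadratic Pfister form of one of the types (a') `⟨⟨h,g]]` with `F(℘⁻¹(g)) ⊆ E`;
(b) `⟨⟨g,h]]` with `F(√g) ⊆ E`; (c) `⟨⟨f_C(e), d/e²]]` with `e ∈ F*`, `f_C(e) ≠ 0`. -/
def IsKernelPf2 (F : Type) [Field F] (E : Type) [Field E] [Algebra F E]
    (a b c d : F) (π : QF F 4) : Prop :=
  (∃ h g : F, h ≠ 0 ∧ (∃ β : E, β ^ 2 + β + algebraMap F E g = 0) ∧ π = pf2 F h g) ∨
  (∃ g h : F, g ≠ 0 ∧ (∃ β : E, β ^ 2 = algebraMap F E g) ∧ π = pf2 F g h) ∨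
  (∃ e : F, e ≠ 0 ∧ cubicResolvent F a b c d e ≠ 0 ∧
      π = pf2 F (cubicResolvent F a b c d e) (d / e ^ 2))


section Isometries

variable {F : Type} [Field F] {M N P : Type} [AddCommGroup M] [Module F M] [AddCommGroup N]
  [Module F N] [AddCommGroup P] [Module F P]

theorem QIsometric.symm {q₁ : QuadraticForm F M} {q₂ : QuadraticForm F N}
    (h : QIsometric F q₁ q₂) : QIsometric F q₂ q₁ :=
  h.map QuadraticMap.IsometryEquiv.symm

theorem QIsometric.trans {q₁ : QuadraticForm F M} {q₂ : QuadraticForm F N}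
    {q₃ : QuadraticForm F P} (h : QIsometric F q₁ q₂) (h' : QIsometric F q₂ q₃) :
    QIsometric F q₁ q₃ :=
  h.elim fun e => h'.map e.trans

/-- A form-preserving linear map out of a nonsingular space of the same dimension is an
isometry. -/
theorem qIsometric_of_map [FiniteDimensional F M] [FiniteDimensional F N]
    {q₁ : QuadraticForm F M} {q₂ : QuadraticForm F N} (hns : Nonsingular F q₁) (f : M →ₗ[F] N)
    (hf : ∀ x, q₂ (f x) = q₁ x) (hdim : Module.finrank F M = Module.finrank F N) :
    QIsometric F q₁ q₂ := by
  have hinj : Function.Injective f := by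
    rw [injective_iff_map_eq_zero]
    intro x hx
    refine hns x fun y => ?_
    simp only [polar, ← hf, map_add, hx, zero_add, QuadraticMap.map_zero]
    ring
  exact ⟨{ LinearEquiv.ofInjectiveOfFinrankEq f hinj hdim with
    map_app' := hf }⟩

theorem binQF_apply (a b : F) (x : Fin 2 → F) :
    binQF F a b x = a * x 0 ^ 2 + x 0 * x 1 + b * x 1 ^ 2 := by
  simp [binQF, Matrix.toQuadraticMap', Matrix.toQuadraticForm', LinearMap.BilinMap.toQuadraticMap_apply,
    Matrix.toLinearMap₂'_apply, Fin.sum_univ_two]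
  ring

theorem oSum_apply {n m : ℕ} (q₁ : QF F n) (q₂ : QF F m) (x : Fin (n + m) → F) :
    oSum F q₁ q₂ x = q₁ (fun i => x (Fin.castAdd m i)) + q₂ (fun i => x (Fin.natAdd n i)) := by
  simp only [oSum, QuadraticMap.comp_apply, QuadraticMap.prod_apply]
  rfl

theorem oSumFam_apply {k n : ℕ} (q : Fin k → QF F n) (x : Fin (k * n) → F) :
    oSumFam F q x = ∑ i, q i (fun j => x (finProdFinEquiv (i, j))) := by
  simp only [oSumFam, QuadraticMap.comp_apply, QuadraticMap.pi_apply]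
  rfl

theorem pf2_apply (g h : F) (x : Fin 4 → F) :
    pf2 F g h x = x 0 ^ 2 + x 0 * x 1 + h * x 1 ^ 2 +
      g * (x 2 ^ 2 + x 2 * x 3 + h * x 3 ^ 2) := by
  refine (oSum_apply (n := 2) (m := 2) _ _ x).trans ?_
  simp [binQF_apply]

theorem diagQF_zero_apply {n : ℕ} (x : Fin n → F) : diagQF F (0 : Fin n → F) x = 0 := by
  simp [diagQF, QuadraticMap.weightedSumSquares_apply]

theorem nonsingular_pf2 {g h : F} (hg : g ≠ 0) [CharP F 2] : Nonsingular F (pf2 F g h) := by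
  intro x hx
  have h0 := hx (Pi.single 0 1)
  have h1 := hx (Pi.single 1 1)
  have h2 := hx (Pi.single 2 1)
  have h3 := hx (Pi.single 3 1)
  simp [polar, pf2_apply] at h0 h1 h2 h3
  ext i
  fin_cases i <;> simp <;> grind

theorem oSum_congr {n m n' m' : ℕ} {q₁ : QF F n} {q₂ : QF F m} {q₁' : QF F n'} {q₂' : QF F m'}
    (h₁ : QIsometric F q₁ q₁') (h₂ : QIsometric F q₂ q₂') :
    QIsometric F (oSum F q₁ q₂) (oSum F q₁' q₂') := by
  obtain ⟨e₁⟩ := h₁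
  obtain ⟨e₂⟩ := h₂
  let L (a b : ℕ) := (LinearEquiv.funCongrLeft F F (finSumFinEquiv (m := a) (n := b))).trans
    (LinearEquiv.sumArrowLequivProdArrow (Fin a) (Fin b) F F)
  refine ⟨{ ((L n m).trans (e₁.toLinearEquiv.prodCongr e₂.toLinearEquiv)).trans (L n' m').symm with
    map_app' := fun x => ?_ }⟩
  change (QuadraticMap.prod q₁' q₂') (L n' m' ((L n' m').symm _)) =
    (QuadraticMap.prod q₁ q₂) (L n m x)
  rw [LinearEquiv.apply_symm_apply]
  simp

theorem smul_congr {q₁ : QuadraticForm F M} {q₂ : QuadraticForm F N} (c : F)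
    (h : QIsometric F q₁ q₂) : QIsometric F (c • q₁) (c • q₂) := by
  obtain ⟨e⟩ := h
  exact ⟨{ e.toLinearEquiv with
    map_app' := fun x => by
      change (c • q₂) (e x) = (c • q₁) x
      simp }⟩

end Isometries

section Arf

variable {F : Type} [Field F] {V : Type} [AddCommGroup V] [Module F V]
  {ι : Type} [Fintype ι] [DecidableEq ι]

theorem polar_sum_left (q : QuadraticForm F V) {κ : Type} (s : Finset κ) (u : κ → V) (y : V) :
    polar q (∑ i ∈ s, u i) y = ∑ i ∈ s, polar q (u i) y := by
  change q.polarBilin _ y = _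
  rw [map_sum, LinearMap.sum_apply]
  rfl

theorem map_sum_of_orthogonal (q : QuadraticForm F V) {κ : Type} [DecidableEq κ]
    (s : Finset κ) (u : κ → V) (h : ∀ i j, i ≠ j → polar q (u i) (u j) = 0) :
    q (∑ i ∈ s, u i) = ∑ i ∈ s, q (u i) := by
  induction s using Finset.induction_on with
  | empty => simp
  | insert k s hk ih =>
    rw [Finset.sum_insert hk, Finset.sum_insert hk, QuadraticMap.map_add q, ih, polar_comm,
      polar_sum_left, Finset.sum_eq_zero fun i hi => h i k fun hik => hk (hik ▸ hi), add_zero]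

theorem polar_self_eq_zero [CharP F 2] (q : QuadraticForm F V) (x : V) : polar q x x = 0 := by
  rw [QuadraticMap.polar_self, two_smul]
  exact CharTwo.add_self_eq_zero _

/-- A family of pairwise orthogonal hyperbolic pairs for the polar form of `q`. -/
structure SymplecticFamily (q : QuadraticForm F V) (e f : ι → V) : Prop where
  left : ∀ i j, polar q (e i) (e j) = 0
  right : ∀ i j, polar q (f i) (f j) = 0
  pair : ∀ i j, polar q (e i) (f j) = if i = j then 1 else 0

/-- The Arf sum of a pair of families of vectors. -/
def arfSum (q : QuadraticForm F V) (e f : ι → V) : F := ∑ i, q (e i) * q (f i)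

namespace SymplecticFamily

variable {q : QuadraticForm F V} {e f : ι → V}

theorem polar_right (h : SymplecticFamily q e f) (i j : ι) :
    polar q (f i) (e j) = if i = j then 1 else 0 := by
  rw [polar_comm, h.pair]
  simp [eq_comm]

theorem expand [FiniteDimensional F V] (h : SymplecticFamily q e f)
    (hdim : Module.finrank F V = 2 * Fintype.card ι) (v : V) :
    v = ∑ i, (polar q v (f i) • e i + polar q v (e i) • f i) := by
  let Ψ : V →ₗ[F] (ι → F) × (ι → F) :=
    (LinearMap.pi fun i => q.polarBilin.flip (f i)).prod
      (LinearMap.pi fun i => q.polarBilin.flip (e i))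
  have key (x y : ι → F) : Ψ (∑ i, (x i • e i + y i • f i)) = (x, y) := by
    refine Prod.ext (funext fun j => ?_) (funext fun j => ?_)
    · change polar q _ _ = _
      simp [polar_sum_left, polar_add_left, polar_smul_left, h.pair, h.right]
    · change polar q _ _ = _
      simp [polar_sum_left, polar_add_left, polar_smul_left, h.polar_right, h.left]
  have hinj : Function.Injective Ψ := by
    rw [LinearMap.injective_iff_surjective_of_finrank_eq_finrank]
    · exact fun p => ⟨_, key p.1 p.2⟩
    · rw [hdim, Module.finrank_prod, Module.finrank_fintype_fun_eq_card, two_mul]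
  exact hinj (key _ _).symm

theorem map_eq [FiniteDimensional F V] (h : SymplecticFamily q e f)
    (hdim : Module.finrank F V = 2 * Fintype.card ι) (v : V) :
    q v = ∑ i, (polar q v (f i) ^ 2 * q (e i) + polar q v (e i) ^ 2 * q (f i) +
      polar q v (f i) * polar q v (e i)) := by
  conv_lhs => rw [h.expand hdim v]
  rw [map_sum_of_orthogonal]
  · refine Finset.sum_congr rfl fun i _ => ?_
    rw [QuadraticMap.map_add q, QuadraticMap.map_smul, QuadraticMap.map_smul, polar_smul_left,
      polar_smul_right, h.pair, if_pos rfl]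
    simp only [smul_eq_mul]
    ring
  · intro i j hij
    simp [polar_add_left, polar_add_right, polar_smul_left, polar_smul_right, h.left, h.right,
      h.pair, h.polar_right, hij]

end SymplecticFamily

/-- The transvection `x ↦ x + ε B(x,v) v` of the polar form of `q`. -/
def transvect (q : QuadraticForm F V) (ε : F) (v x : V) : V := x + (ε * polar q x v) • v

variable [CharP F 2] {q : QuadraticForm F V} {e f : ι → V}

theorem polar_transvect (ε : F) (v x y : V) :
    polar q (transvect q ε v x) (transvect q ε v y) = polar q x y := by
  simp only [transvect, polar_add_left, polar_add_right, polar_smul_left, polar_smul_right,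
    polar_self_eq_zero, polar_comm q v y, smul_eq_mul]
  grind

theorem map_transvect (ε : F) (v x : V) :
    q (transvect q ε v x) = q x + (ε + ε ^ 2 * q v) * polar q x v ^ 2 := by
  simp only [transvect, QuadraticMap.map_add, QuadraticMap.map_smul, polar_smul_right,
    smul_eq_mul]
  ring

theorem SymplecticFamily.transvect (h : SymplecticFamily q e f) (ε : F) (v : V) :
    SymplecticFamily q (fun i => transvect q ε v (e i)) (fun i => transvect q ε v (f i)) where
  left i j := by rw [polar_transvect, h.left]
  right i j := by rw [polar_transvect, h.right]
  pair i j := by rw [polar_transvect, h.pair]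

theorem arfSum_transvect [FiniteDimensional F V] (h : SymplecticFamily q e f)
    (hdim : Module.finrank F V = 2 * Fintype.card ι) (ε : F) (v : V) :
    ∃ l : F, arfSum q (fun i => transvect q ε v (e i)) (fun i => transvect q ε v (f i)) =
      arfSum q e f + (l ^ 2 + l) := by
  set P := ∑ i, polar q v (f i) * polar q v (e i) with hP
  have hq := h.map_eq hdim v
  rw [Finset.sum_add_distrib, ← hP] at hq
  have hP2 : P ^ 2 = ∑ i, (polar q v (f i) * polar q v (e i)) ^ 2 := sum_pow_char 2 _ _
  refine ⟨(ε + ε ^ 2 * q v) * P + ε * q v, ?_⟩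
  have : arfSum q (fun i => transvect q ε v (e i)) (fun i => transvect q ε v (f i)) =
      arfSum q e f + (ε + ε ^ 2 * q v) *
        (∑ i, (polar q v (f i) ^ 2 * q (e i) + polar q v (e i) ^ 2 * q (f i))) +
      (ε + ε ^ 2 * q v) ^ 2 * P ^ 2 := by
    rw [hP2, Finset.mul_sum, Finset.mul_sum, arfSum, arfSum, ← Finset.sum_add_distrib,
      ← Finset.sum_add_distrib]
    refine Finset.sum_congr rfl fun i _ => ?_
    rw [map_transvect, map_transvect, polar_comm q v, polar_comm q v]
    ring
  rw [this]
  grind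

/-- The families congruent to `(e, f)` in Arf sum and agreeing with `(e', f')` on `s`. -/
structure ArfLinked (q : QuadraticForm F V) (A : F) (e' f' : ι → V) (s : Finset ι)
    (e f : ι → V) : Prop where
  symp : SymplecticFamily q e f
  eqL : ∀ i ∈ s, e i = e' i
  eqR : ∀ i ∈ s, f i = f' i
  arf : ∃ l : F, arfSum q e f = A + (l ^ 2 + l)

variable {A : F} {e' f' : ι → V} {s : Finset ι}

theorem transvect_of_polar_eq_zero {ε : F} {v x : V} (h : polar q x v = 0) :
    transvect q ε v x = x := by
  simp [transvect, h]

theorem transvect_add {x y : V} (h : polar q x y ≠ 0) :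
    transvect q (polar q x y)⁻¹ (x + y) x = y := by
  rw [transvect, polar_add_right, polar_self_eq_zero, zero_add, inv_mul_cancel₀ h, one_smul,
    ← add_assoc, ← two_smul F x, CharTwo.two_eq_zero, zero_smul, zero_add]

theorem ArfLinked.transvect [FiniteDimensional F V] (h : ArfLinked q A e' f' s e f)
    (hdim : Module.finrank F V = 2 * Fintype.card ι) (ε : F) {v : V}
    (hl : ∀ i ∈ s, polar q (e' i) v = 0) (hr : ∀ i ∈ s, polar q (f' i) v = 0) :
    ArfLinked q A e' f' s (fun i => transvect q ε v (e i)) (fun i => transvect q ε v (f i)) where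
  symp := h.symp.transvect ε v
  eqL i hi := by rw [h.eqL i hi, transvect_of_polar_eq_zero (hl i hi)]
  eqR i hi := by rw [h.eqR i hi, transvect_of_polar_eq_zero (hr i hi)]
  arf := by
    obtain ⟨l, hl⟩ := h.arf
    obtain ⟨l', hl'⟩ := arfSum_transvect h.symp hdim ε v
    exact ⟨l + l', by rw [hl', hl]; grind⟩

theorem ArfLinked.move_left [FiniteDimensional F V] (h : ArfLinked q A e' f' s e f)
    (h' : SymplecticFamily q e' f')
    (hdim : Module.finrank F V = 2 * Fintype.card ι) {k : ι} (hk : k ∉ s) :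
    ∃ e₁ f₁, ArfLinked q A e' f' s e₁ f₁ ∧ e₁ k = e' k := by
  have hne : ∀ i ∈ s, i ≠ k := fun i hi hik => hk (hik ▸ hi)
  have move : ∀ {e f : ι → V} (z : V), ArfLinked q A e' f' s e f → polar q (e k) z ≠ 0 →
      (∀ i ∈ s, polar q (e' i) z = 0) → (∀ i ∈ s, polar q (f' i) z = 0) →
      ∃ e₁ f₁, ArfLinked q A e' f' s e₁ f₁ ∧ e₁ k = z := by
    intro e f z h hz hl hr
    refine ⟨_, _, h.transvect hdim (polar q (e k) z)⁻¹ (v := e k + z) ?_ ?_, transvect_add hz⟩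
    · intro i hi
      rw [polar_add_right, hl i hi, ← h.eqL i hi, h.symp.left, add_zero]
    · intro i hi
      rw [polar_add_right, hr i hi, ← h.eqR i hi, h.symp.polar_right, if_neg (hne i hi), add_zero]
  have hl' : ∀ i ∈ s, polar q (e' i) (e' k) = 0 := fun i _ => h'.left i k
  have hr' : ∀ i ∈ s, polar q (f' i) (e' k) = 0 := fun i hi => by
    rw [h'.polar_right, if_neg (hne i hi)]
  have through : ∀ z : V, polar q (e k) z ≠ 0 → polar q z (e' k) ≠ 0 →
      (∀ i ∈ s, polar q (e' i) z = 0) → (∀ i ∈ s, polar q (f' i) z = 0) →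
      ∃ e₁ f₁, ArfLinked q A e' f' s e₁ f₁ ∧ e₁ k = e' k := by
    intro z hz hz' hl hr
    obtain ⟨e₁, f₁, h₁, rfl⟩ := move z h hz hl hr
    exact move _ h₁ hz' hl' hr'
  have hl₁ : ∀ i ∈ s, polar q (e' i) (f k) = 0 := fun i hi => by
    rw [← h.eqL i hi, h.symp.pair, if_neg (hne i hi)]
  have hr₁ : ∀ i ∈ s, polar q (f' i) (f k) = 0 := fun i hi => by
    rw [← h.eqR i hi, h.symp.right]
  have hl₂ : ∀ i ∈ s, polar q (e' i) (f' k) = 0 := fun i hi => by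
    rw [h'.pair, if_neg (hne i hi)]
  have hr₂ : ∀ i ∈ s, polar q (f' i) (f' k) = 0 := fun i _ => h'.right i k
  have h1 : polar q (e k) (f k) = 1 := by simp [h.symp.pair]
  have h2 : polar q (f' k) (e' k) = 1 := by simp [h'.polar_right]
  by_cases c1 : polar q (f k) (e' k) = 0
  · by_cases c2 : polar q (e k) (f' k) = 0
    · refine through (f k + f' k) ?_ ?_ ?_ ?_
      · simp [polar_add_right, c2, h1]
      · simp [polar_add_left, c1, h2]
      · exact fun i hi => by rw [polar_add_right, hl₁ i hi, hl₂ i hi, add_zero]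
      · exact fun i hi => by rw [polar_add_right, hr₁ i hi, hr₂ i hi, add_zero]
    · exact through (f' k) c2 (by simp [h2]) hl₂ hr₂
  · exact through (f k) (by simp [h1]) c1 hl₁ hr₁

theorem ArfLinked.move_right [FiniteDimensional F V] (h : ArfLinked q A e' f' s e f)
    (h' : SymplecticFamily q e' f')
    (hdim : Module.finrank F V = 2 * Fintype.card ι) {k : ι} (hk : k ∉ s) (hek : e k = e' k) :
    ∃ e₁ f₁, ArfLinked q A e' f' (insert k s) e₁ f₁ := by
  have hne : ∀ i ∈ s, i ≠ k := fun i hi hik => hk (hik ▸ hi)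
  have move : ∀ {e f : ι → V}, ArfLinked q A e' f' s e f → e k = e' k →
      polar q (f k) (f' k) ≠ 0 → ∃ e₁ f₁, ArfLinked q A e' f' (insert k s) e₁ f₁ := by
    intro e f h hek hz
    have := h.transvect hdim (polar q (f k) (f' k))⁻¹ (v := f k + f' k)
      (fun i hi => by
        rw [polar_add_right, h'.pair, ← h.eqL i hi, h.symp.pair, if_neg (hne i hi), add_zero])
      (fun i hi => by rw [polar_add_right, h'.right, ← h.eqR i hi, h.symp.right, add_zero])
    refine ⟨_, _, this.symp, ?_, ?_, this.arf⟩
    · intro i hi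
      rcases Finset.mem_insert.1 hi with rfl | hi
      · rw [transvect_of_polar_eq_zero, hek]
        rw [polar_add_right, h.symp.pair, hek, h'.pair]
        exact CharTwo.add_self_eq_zero _
      · exact this.eqL i hi
    · intro i hi
      rcases Finset.mem_insert.1 hi with rfl | hi
      · exact transvect_add hz
      · exact this.eqR i hi
  by_cases c : polar q (f k) (f' k) = 0
  · have := h.transvect hdim 1 (v := e k)
      (fun i hi => by rw [← h.eqL i hi, h.symp.left])
      (fun i hi => by rw [← h.eqR i hi, h.symp.polar_right, if_neg (hne i hi)])
    refine move this ?_ ?_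
    · rw [transvect_of_polar_eq_zero (polar_self_eq_zero q _), hek]
    · simp only [_root_.transvect]
      have h1 : polar q (f k) (e' k) = 1 := by rw [← hek, h.symp.polar_right, if_pos rfl]
      simp [polar_add_left, c, hek, h1, h'.pair]
  · exact move h hek c

/-- The Arf sum of a symplectic basis does not depend on the basis modulo `℘(F)`. -/
theorem arfSum_congr [FiniteDimensional F V] (h : SymplecticFamily q e f)
    (h' : SymplecticFamily q e' f') (hdim : Module.finrank F V = 2 * Fintype.card ι) :
    ∃ l : F, arfSum q e' f' = arfSum q e f + (l ^ 2 + l) := by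
  have key : ∀ s : Finset ι, ∃ e₁ f₁, ArfLinked q (arfSum q e f) e' f' s e₁ f₁ := by
    intro s
    induction s using Finset.induction_on with
    | empty => exact ⟨e, f, h, by simp, by simp, 0, by simp⟩
    | insert k s hk ih =>
      obtain ⟨e₁, f₁, h₁⟩ := ih
      obtain ⟨e₂, f₂, h₂, hk₂⟩ := h₁.move_left h' hdim hk
      exact h₂.move_right h' hdim hk hk₂
  obtain ⟨e₁, f₁, h₁⟩ := key Finset.univ
  obtain rfl : e₁ = e' := funext fun i => h₁.eqL i (Finset.mem_univ i)
  obtain rfl : f₁ = f' := funext fun i => h₁.eqR i (Finset.mem_univ i)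
  exact h₁.arf

end Arf

section Extension

variable {F : Type} [Field F] {E : Type} [Field E] [Algebra F E] {n : ℕ}

/-- The coordinatewise inclusion `F^n → E^n`. -/
def coordMap (F E : Type) [Field F] [Field E] [Algebra F E] (n : ℕ) :
    (Fin n → F) →ₗ[F] (Fin n → E) :=
  (Algebra.linearMap F E).compLeft (Fin n)

theorem coordMap_apply (v : Fin n → F) (i : Fin n) :
    coordMap F E n v i = algebraMap F E (v i) := rfl

theorem map_eq_sum_qMat (q : QF F n) (x : Fin n → F) :
    q x = ∑ i, ∑ j, x i * (x j * qMat F q i j) := by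
  have h : q.toBilin (Pi.basisFun F (Fin n)) = Matrix.toLinearMap₂' F (qMat F q) := by
    refine (Pi.basisFun F (Fin n)).ext fun i => (Pi.basisFun F (Fin n)).ext fun j => ?_
    rw [toBilin_apply]
    simp only [Pi.basisFun_apply]
    exact (Matrix.toLinearMap₂'Aux_single (RingHom.id F) (RingHom.id F) (qMat F q) i j).symm
  conv_lhs => rw [← q.toQuadraticMap_toBilin (Pi.basisFun F (Fin n)), h]
  simp [LinearMap.BilinMap.toQuadraticMap_apply, Matrix.toLinearMap₂'_apply]

theorem extQF_coordMap (q : QF F n) (v : Fin n → F) :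
    extQF F E q (coordMap F E n v) = algebraMap F E (q v) := by
  rw [map_eq_sum_qMat q v]
  simp [extQF, Matrix.toQuadraticMap', Matrix.toQuadraticForm',
    LinearMap.BilinMap.toQuadraticMap_apply, Matrix.toLinearMap₂'_apply, coordMap_apply]

theorem polar_coordMap {q : QF F n} {Q : QF E n}
    (hQ : ∀ v, Q (coordMap F E n v) = algebraMap F E (q v)) (v w : Fin n → F) :
    polar Q (coordMap F E n v) (coordMap F E n w) = algebraMap F E (polar q v w) := by
  simp only [polar, ← map_add, hQ, map_sub]

/-- A form in the Witt kernel becomes totally isotropic on a subspace of at least half the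
dimension. -/
theorem InWqKernel.exists_submodule {q : QF F n} (h : InWqKernel F E q) :
    ∃ L : Submodule E (Fin n → E), n ≤ 2 * Module.finrank E L ∧ ∀ x ∈ L, extQF F E q x = 0 := by
  obtain ⟨r, ρ, -, ⟨i, j, ⟨e⟩⟩, ⟨i', j', ⟨e'⟩⟩⟩ := h
  have hr := e'.toLinearEquiv.finrank_eq
  have hn := e.toLinearEquiv.finrank_eq
  simp only [Module.finrank_fintype_fun_eq_card, Fintype.card_fin] at hr hn
  obtain rfl : r = 0 := by omega
  let g : (Fin n → E) →ₗ[E] (Fin i → E) :=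
    (LinearMap.funLeft E E fun k => Fin.castAdd j (Fin.castAdd 0 (finProdFinEquiv (k, 1)))) ∘ₗ
      e.toLinearEquiv.toLinearMap
  refine ⟨LinearMap.ker g, ?_, fun x hx => ?_⟩
  · have h1 := g.finrank_range_add_finrank_ker
    have h2 := (LinearMap.range g).finrank_le
    simp only [Module.finrank_fintype_fun_eq_card, Fintype.card_fin] at h1 h2
    omega
  · have hx' (k : Fin i) :
        e x (Fin.castAdd j (Fin.castAdd 0 (finProdFinEquiv (k, 1)))) = 0 := congrFun hx k
    rw [← e.map_app, oSum_apply, diagQF_zero_apply, oSum_apply, oSumFam_apply]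
    have hρ (y : Fin 0 → E) : ρ y = 0 := by rw [Subsingleton.elim y 0, QuadraticMap.map_zero]
    simp only [binQF_apply, hx', hρ]
    simp

/-- The field generator data used throughout: `α` is a root of
`X⁴ + aX³ + bX² + cX + d` of degree four. -/
structure QuarticRoot (a b c d : F) (α : E) : Prop where
  root : α ^ 4 + algebraMap F E a * α ^ 3 + algebraMap F E b * α ^ 2
    + algebraMap F E c * α + algebraMap F E d = 0
  finrank : Module.finrank F E = 4
  indep : ∀ t₀ t₁ t₂ t₃ : F, algebraMap F E t₀ + algebraMap F E t₁ * α +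
    algebraMap F E t₂ * α ^ 2 + algebraMap F E t₃ * α ^ 3 = 0 →
    t₀ = 0 ∧ t₁ = 0 ∧ t₂ = 0 ∧ t₃ = 0

theorem QuarticRoot.of_adjoin {a b c d : F} {α : E}
    (hα : α ^ 4 + algebraMap F E a * α ^ 3 + algebraMap F E b * α ^ 2
        + algebraMap F E c * α + algebraMap F E d = 0)
    (hdim : Module.finrank F E = 4)
    (hE : IntermediateField.adjoin F {α} = ⊤) : QuarticRoot a b c d α := by
  refine ⟨hα, hdim, fun t₀ t₁ t₂ t₃ h => ?_⟩
  have : FiniteDimensional F E := Module.finite_of_finrank_pos (by omega)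
  have hdeg : (minpoly F α).natDegree = 4 := by
    rw [← IntermediateField.adjoin.finrank (Algebra.IsIntegral.isIntegral α), hE,
      IntermediateField.finrank_top', hdim]
  have hli := linearIndependent_pow (K := F) α
  rw [hdeg, Fintype.linearIndependent_iff] at hli
  have := hli ![t₀, t₁, t₂, t₃] (by
    simp only [Fin.sum_univ_four, Algebra.smul_def]
    simpa using h)
  exact ⟨this 0, this 1, this 2, this 3⟩

variable {a b c d : F} {α : E} {q : QF F n} {Q : QF E n}

/-- The relations expressing that `v₀ + α v₁ + α² v₂` is isotropic. -/
structure QuarticRel {V : Type} [AddCommGroup V] [Module F V] (q : QuadraticForm F V)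
    (a b c d : F) (v₀ v₁ v₂ : V) : Prop where
  h12 : polar q v₁ v₂ = a * q v₂
  h11 : q v₁ = b * q v₂ + polar q v₀ v₂
  h01 : polar q v₀ v₁ = c * q v₂
  h00 : q v₀ = d * q v₂

theorem QuarticRoot.quarticRel [CharP F 2] (hα : QuarticRoot a b c d α)
    (hQ : ∀ v, Q (coordMap F E n v) = algebraMap F E (q v)) {v₀ v₁ v₂ : Fin n → F}
    (h : Q (coordMap F E n v₀ + α • coordMap F E n v₁ + α ^ 2 • coordMap F E n v₂) = 0) :
    QuarticRel q a b c d v₀ v₁ v₂ := by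
  simp only [QuadraticMap.map_add Q, QuadraticMap.map_smul, polar_add_left, polar_smul_left,
    polar_smul_right, hQ, polar_coordMap hQ, smul_eq_mul] at h
  obtain ⟨h0, h1, h2, h3⟩ := hα.indep (q v₀ - d * q v₂) (polar q v₀ v₁ - c * q v₂)
    (q v₁ + polar q v₀ v₂ - b * q v₂) (polar q v₁ v₂ - a * q v₂) (by
      simp only [map_sub, map_add, map_mul]
      linear_combination h - algebraMap F E (q v₂) * hα.root)
  have h2' : q v₁ + polar q v₀ v₂ = b * q v₂ := by grind
  constructor <;> grind

/-- An anisotropic form that is totally isotropic on a half-dimensional subspace over the quartic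
extension `E = F(α)` carries a pair of operators completing every vector to an isotropic
`T v + α S v + α² v`. -/
theorem QuarticRoot.exists_operators (hα : QuarticRoot a b c d α) [CharP F 2]
    (hQ : ∀ v, Q (coordMap F E n v) = algebraMap F E (q v)) (han : q.Anisotropic)
    {L : Submodule E (Fin n → E)} (hL : n ≤ 2 * Module.finrank E L) (hLQ : ∀ x ∈ L, Q x = 0) :
    ∃ S T : (Fin n → F) →ₗ[F] (Fin n → F), ∀ v,
      QuarticRel q a b c d (T v) (S v) v := by
  have : FiniteDimensional F E := Module.finite_of_finrank_pos (by rw [hα.finrank]; omega)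
  let V := Fin n → F
  let j := coordMap F E n
  let z : (V × V × V) →ₗ[F] (Fin n → E) :=
    j.coprod ((α • j).coprod (α ^ 2 • j))
  have hz (v₀ v₁ v₂ : V) : z (v₀, v₁, v₂) = j v₀ + α • j v₁ + α ^ 2 • j v₂ := by
    simp [z, add_assoc]
  let LF := L.restrictScalars F
  let Θ : (V × V × V) →ₗ[F] ((Fin n → E) ⧸ LF) := LF.mkQ ∘ₗ z
  let W := LinearMap.ker Θ
  have hW : ∀ w ∈ W, QuarticRel q a b c d w.1 w.2.1 w.2.2 := by
    rintro ⟨v₀, v₁, v₂⟩ hw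
    refine hα.quarticRel hQ (hLQ _ ?_)
    rw [← hz]
    exact (Submodule.Quotient.mk_eq_zero LF).1 hw
  let p : W →ₗ[F] V := LinearMap.snd F V V ∘ₗ LinearMap.snd F V (V × V) ∘ₗ W.subtype
  have hp : Function.Injective p := by
    rw [injective_iff_map_eq_zero]
    rintro ⟨⟨v₀, v₁, v₂⟩, hw⟩ (rfl : v₂ = 0)
    have := hW _ hw
    obtain rfl : v₁ = 0 := han _ (by simpa using this.h11)
    obtain rfl : v₀ = 0 := han _ (by simpa using this.h00)
    rfl
  have hdimW : Module.finrank F W = Module.finrank F V := by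
    refine le_antisymm (LinearMap.finrank_le_finrank_of_injective hp) ?_
    have h1 := Θ.finrank_range_add_finrank_ker
    have h2 := (LinearMap.range Θ).finrank_le
    have h3 := LF.finrank_quotient_add_finrank
    have h4 : Module.finrank F LF = 4 * Module.finrank E L := by
      rw [← hα.finrank, Module.finrank_mul_finrank F E L]
      rfl
    have h5 : Module.finrank F (Fin n → E) = 4 * n := by
      rw [← hα.finrank, ← Module.finrank_mul_finrank F E (Fin n → E)]
      simp
    have h6 : Module.finrank F (V × V × V) = 3 * n := by
      simp [V]; ring
    have h7 : Module.finrank F V = n := by simp [V]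
    change Module.finrank F V ≤ Module.finrank F (LinearMap.ker Θ)
    omega
  let e := LinearEquiv.ofInjectiveOfFinrankEq p hp hdimW
  refine ⟨LinearMap.fst F V V ∘ₗ LinearMap.snd F V (V × V) ∘ₗ W.subtype ∘ₗ e.symm.toLinearMap,
    LinearMap.fst F V (V × V) ∘ₗ W.subtype ∘ₗ e.symm.toLinearMap, fun v => ?_⟩
  have := hW _ (e.symm v).2
  have he : (e.symm v).1.2.2 = v := e.apply_symm_apply v
  rw [he] at this
  exact this

end Extension

section Nonsingular

variable {F : Type} [Field F] {V : Type} [AddCommGroup V] [Module F V] [FiniteDimensional F V]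
  {q : QuadraticForm F V} {κ : Type} [Fintype κ]

theorem Nonsingular.exists_polar_eq (hq : Nonsingular F q) {v : κ → V}
    (hv : LinearIndependent F v) (t : κ → F) : ∃ x, ∀ i, polar q x (v i) = t i := by
  have hinj : Function.Injective q.polarBilin := by
    rw [injective_iff_map_eq_zero]
    exact fun x hx => hq x fun y => LinearMap.congr_fun hx y
  have hsurj : Function.Surjective q.polarBilin :=
    (LinearMap.injective_iff_surjective_of_finrank_eq_finrank
      (Subspace.dual_finrank_eq (K := F) (V := V)).symm).1 hinj
  obtain ⟨g, hg⟩ := LinearMap.exists_extend (Finsupp.linearCombination F t ∘ₗ hv.repr)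
  obtain ⟨x, rfl⟩ := hsurj g
  refine ⟨x, fun i => ?_⟩
  have hi : (Finsupp.linearCombination F t ∘ₗ hv.repr)
      ⟨v i, Submodule.subset_span (Set.mem_range_self i)⟩ = t i := by
    rw [LinearMap.comp_apply]
    erw [hv.repr_eq_single i ⟨v i, _⟩ rfl]
    simp
  rw [← hi, ← hg]
  rfl

theorem Nonsingular.two_mul_card_le (hq : Nonsingular F q) {v : κ → V}
    (hv : LinearIndependent F v) (h0 : ∀ i j, polar q (v i) (v j) = 0) :
    2 * Fintype.card κ ≤ Module.finrank F V := by
  let g : V →ₗ[F] (κ → F) := LinearMap.pi fun i => q.polarBilin.flip (v i)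
  have hg : Function.Surjective g := fun t =>
    (hq.exists_polar_eq hv t).imp fun x hx => funext hx
  have h1 := g.finrank_range_add_finrank_ker
  rw [LinearMap.range_eq_top.2 hg, finrank_top, Module.finrank_fintype_fun_eq_card] at h1
  have h2 : Submodule.span F (Set.range v) ≤ LinearMap.ker g := by
    rw [Submodule.span_le]
    rintro _ ⟨i, rfl⟩
    exact funext fun j => h0 i j
  have h3 := Submodule.finrank_mono h2
  rw [finrank_span_eq_card hv] at h3
  omega

theorem exists_ne_zero_polar_eq_zero (q : QuadraticForm F V) (v : κ → V)
    (h : Fintype.card κ < Module.finrank F V) : ∃ x, x ≠ 0 ∧ ∀ i, polar q x (v i) = 0 := by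
  let g : V →ₗ[F] (κ → F) := LinearMap.pi fun i => q.polarBilin.flip (v i)
  have hg : LinearMap.ker g ≠ ⊥ := LinearMap.ker_ne_bot_of_finrank_lt (by
    rwa [Module.finrank_fintype_fun_eq_card])
  obtain ⟨x, hx, hx0⟩ := (Submodule.ne_bot_iff _).1 hg
  exact ⟨x, hx0, fun i => congrFun hx i⟩

end Nonsingular

section QuarticCases

variable {F : Type} [Field F] [CharP F 2] {E : Type} [Field E] [Algebra F E] {a b c d : F} {α : E}

theorem QuarticRoot.charP (_ : QuarticRoot a b c d α) : CharP E 2 :=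
  charP_of_injective_algebraMap (algebraMap F E).injective 2

theorem QuarticRoot.ne_zero (hα : QuarticRoot a b c d α) : α ≠ 0 := by
  rintro rfl
  simpa using hα.indep 0 1 0 0 (by simp)

theorem QuarticRoot.add_mul_ne_zero (hα : QuarticRoot a b c d α) {s t : F}
    (h : s ≠ 0 ∨ t ≠ 0) : algebraMap F E s + algebraMap F E t * α ≠ 0 := fun h0 => by
  have := hα.indep s t 0 0 (by simpa using h0)
  tauto

theorem QuarticRoot.resolvent_eq (hα : QuarticRoot a b c d α) {e : F} (he : e ≠ 0) :
    (α ^ 2 + algebraMap F E (c / e) * α) ^ 2 +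
      (α ^ 2 + algebraMap F E (c / e) * α) * (algebraMap F E e + algebraMap F E a * α) +
      algebraMap F E (d / e ^ 2) * (algebraMap F E e + algebraMap F E a * α) ^ 2 =
      α ^ 2 * algebraMap F E (cubicResolvent F a b c d e / e ^ 2) := by
  have := hα.charP
  have he' : algebraMap F E e ≠ 0 := by simpa using he
  simp only [cubicResolvent, map_div₀, map_add, map_mul, map_pow]
  field_simp
  linear_combination (algebraMap F E e) ^ 2 * hα.root +
    (α * algebraMap F E e * algebraMap F E a * algebraMap F E d
      - α ^ 2 * algebraMap F E e ^ 2 * algebraMap F E b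
      + α ^ 3 * algebraMap F E e * algebraMap F E c) * CharTwo.two_eq_zero (R := E)

theorem QuarticRoot.split_resolvent (hα : QuarticRoot a b c d α) {e : F} (he : e ≠ 0) :
    ∃ x y : E, x ^ 2 + x * y + algebraMap F E (d / e ^ 2) * y ^ 2 =
      algebraMap F E (cubicResolvent F a b c d e / e ^ 2) := by
  have h0 := hα.ne_zero
  refine ⟨(α ^ 2 + algebraMap F E (c / e) * α) / α,
    (algebraMap F E e + algebraMap F E a * α) / α, ?_⟩
  have := hα.resolvent_eq he
  generalize algebraMap F E (d / e ^ 2) = u at *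
  generalize algebraMap F E (cubicResolvent F a b c d e / e ^ 2) = h at *
  field_simp
  linear_combination this

theorem artinSchreier_root_of_isotropic {x y g : E} (hy : y ≠ 0)
    (h : x ^ 2 + x * y + g * y ^ 2 = 0) : (x / y) ^ 2 + x / y + g = 0 := by
  field_simp
  linear_combination h

variable {V : Type} [AddCommGroup V] [Module F V] {q : QuadraticForm F V} {v₀ v₁ v₂ : V}

theorem QuarticRel.cases (hα : QuarticRoot a b c d α) (han : q.Anisotropic)
    (h : QuarticRel q a b c d v₀ v₁ v₂) (h2 : v₂ ≠ 0) :
    (∃ (e : F) (w : V), e ≠ 0 ∧ cubicResolvent F a b c d e ≠ 0 ∧ polar q v₂ v₀ = e * q v₂ ∧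
      polar q w v₀ = 0 ∧ polar q w v₂ = 0 ∧
      q w = q v₂ * (cubicResolvent F a b c d e / e ^ 2)) ∨
    (∃ (p : V) (g : F), polar q v₂ p = q v₂ ∧ q p = q v₂ * g ∧
      ∃ β : E, β ^ 2 + β + algebraMap F E g = 0) ∨
    (∃ (ζ : V) (g : F), LinearIndependent F ![v₂, ζ] ∧ polar q v₂ ζ = 0 ∧ q ζ = q v₂ * g ∧
      ∃ γ : E, γ ^ 2 = algebraMap F E g) ∨
    (polar q v₀ v₂ = 0 ∧ a ^ 2 * d + c ^ 2 ≠ 0) ∨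
    (a = 0 ∧ c = 0 ∧ polar q v₀ v₂ = 0 ∧ LinearIndependent F ![v₁, v₂, v₀]) := by
  have hE := hα.charP
  have hs : q v₂ ≠ 0 := fun h0 => h2 (han _ h0)
  by_cases he : polar q v₀ v₂ = 0
  · by_cases hδ : a ^ 2 * d + c ^ 2 = 0
    · have hv : c • v₂ + a • v₀ = 0 := by
        refine han _ ?_
        simp only [QuadraticMap.map_add q, QuadraticMap.map_smul, polar_smul_left,
          polar_smul_right, polar_comm q v₂ v₀, he, h.h00, smul_eq_mul]
        linear_combination q v₂ * hδ
      by_cases ha : a = 0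
      · obtain rfl : a = 0 := ha
        obtain rfl : c = 0 := by simpa using hδ
        have hr : α ^ 4 + algebraMap F E b * α ^ 2 + algebraMap F E d = 0 := by
          simpa using hα.root
        have h11 : q v₁ = q v₂ * b := by rw [h.h11, he, add_zero, mul_comm]
        have h00 : q v₀ = q v₂ * d := by rw [h.h00, mul_comm]
        have h02 : polar q v₂ v₀ = 0 := by rw [polar_comm, he]
        have h21 : polar q v₂ v₁ = 0 := by rw [polar_comm, h.h12, zero_mul]
        by_cases hk : ∃ k : F, k • v₂ = v₀
        · obtain ⟨k, rfl⟩ := hk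
          obtain rfl : k ^ 2 = d := by
            rw [QuadraticMap.map_smul, smul_eq_mul, mul_comm] at h00
            linear_combination mul_left_cancel₀ hs h00
          refine Or.inr (Or.inr (Or.inl ⟨v₁, b, ?_, h21, h11, (α ^ 2 + algebraMap F E k) / α, ?_⟩))
          · refine (LinearIndependent.pair_iff' h2).2 fun m hm => ?_
            subst hm
            obtain rfl : m ^ 2 = b := by
              rw [QuadraticMap.map_smul, smul_eq_mul, mul_comm] at h11
              linear_combination mul_left_cancel₀ hs h11
            have h0 : (α ^ 2 + algebraMap F E m * α + algebraMap F E k) ^ 2 = 0 := by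
              simp only [map_pow] at hr
              linear_combination hr + (algebraMap F E m * α ^ 3 + algebraMap F E k * α ^ 2 +
                algebraMap F E m * algebraMap F E k * α) * CharTwo.two_eq_zero (R := E)
            have := hα.indep k m 1 0 (by
              rw [map_one, map_zero]
              linear_combination pow_eq_zero_iff two_ne_zero |>.1 h0)
            simp at this
          · have := hα.ne_zero
            simp only [map_pow] at hr
            field_simp
            linear_combination hr + (algebraMap F E k * α ^ 2 - algebraMap F E b * α ^ 2) *
              CharTwo.two_eq_zero (R := E)
        · have hk' : LinearIndependent F ![v₂, v₀] :=
            (LinearIndependent.pair_iff' h2).2 fun k hk₁ => hk ⟨k, hk₁⟩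
          by_cases hxy : v₁ ∈ Submodule.span F (Set.range ![v₂, v₀])
          · rw [Matrix.range_cons_cons_empty, Submodule.mem_span_pair] at hxy
            obtain ⟨y, x, rfl⟩ := hxy
            refine Or.inr (Or.inr (Or.inl ⟨v₀, d, hk', h02, h00,
              (α ^ 2 + algebraMap F E y * α) / (1 + algebraMap F E x * α), ?_⟩))
            have hb : b = y ^ 2 + x ^ 2 * d := by
              simp only [QuadraticMap.map_add q, QuadraticMap.map_smul, polar_smul_left,
                polar_smul_right, h02, h00, smul_eq_mul] at h11
              refine mul_left_cancel₀ hs ?_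
              linear_combination -h11
            have hx : (1 : E) + algebraMap F E x * α ≠ 0 := by
              simpa using hα.add_mul_ne_zero (Or.inl one_ne_zero) (t := x)
            rw [hb] at hr
            simp only [map_pow, map_add, map_mul] at hr
            field_simp
            grind
          · refine Or.inr (Or.inr (Or.inr (Or.inr ⟨rfl, rfl, he,
              linearIndependent_finCons.2 ⟨hk', hxy⟩⟩)))
      · have hd : d = (c / a) ^ 2 := by
          field_simp
          grind
        refine Or.inr (Or.inl ⟨a⁻¹ • v₁, b / a ^ 2, ?_, ?_, ?_⟩)
        · rw [polar_smul_right, polar_comm, h.h12, smul_eq_mul, inv_mul_cancel_left₀ ha]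
        · rw [QuadraticMap.map_smul, h.h11, he, smul_eq_mul]
          field_simp
          ring
        · refine ⟨_, artinSchreier_root_of_isotropic
            (x := α ^ 2 + algebraMap F E (c / a)) (y := algebraMap F E a * α) ?_ ?_⟩
          · exact mul_ne_zero (by simpa using ha) hα.ne_zero
          · have ha' : algebraMap F E a ≠ 0 := by simpa using ha
            have hr := hα.root
            rw [hd] at hr
            simp only [map_div₀, map_pow] at hr ⊢
            field_simp at hr ⊢
            linear_combination hr + (α ^ 2 * algebraMap F E a * algebraMap F E c) *
              CharTwo.two_eq_zero (R := E)
    · exact Or.inr (Or.inr (Or.inr (Or.inl ⟨he, hδ⟩)))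
  · set e := polar q v₀ v₂ / q v₂ with he'
    have he0 : e ≠ 0 := div_ne_zero he hs
    have hes : polar q v₀ v₂ = e * q v₂ := by rw [he', div_mul_cancel₀ _ hs]
    let w := v₁ + (a / e) • v₀ + (c / e) • v₂
    have hw0 : polar q w v₀ = 0 := by
      simp only [w, polar_add_left, polar_smul_left, polar_self_eq_zero, polar_comm q v₁ v₀,
        polar_comm q v₂ v₀, h.h01, hes, smul_eq_mul]
      field_simp
      grind
    have hw2 : polar q w v₂ = 0 := by
      simp only [w, polar_add_left, polar_smul_left, polar_self_eq_zero, h.h12, hes, smul_eq_mul]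
      field_simp
      grind
    have hw : q w = q v₂ * (cubicResolvent F a b c d e / e ^ 2) := by
      simp only [w, QuadraticMap.map_add q, QuadraticMap.map_smul, polar_add_left,
        polar_smul_left, polar_smul_right, polar_comm q v₁ v₀, h.h01, h.h00, h.h11, h.h12, hes,
        smul_eq_mul, cubicResolvent]
      field_simp
      grind
    by_cases hf : cubicResolvent F a b c d e = 0
    · refine Or.inr (Or.inl ⟨e⁻¹ • v₀, d / e ^ 2, ?_, ?_, ?_⟩)
      · rw [polar_smul_right, polar_comm, hes, smul_eq_mul, inv_mul_cancel_left₀ he0]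
      · rw [QuadraticMap.map_smul, h.h00, smul_eq_mul]
        field_simp
      · refine ⟨_, artinSchreier_root_of_isotropic
          (x := α ^ 2 + algebraMap F E (c / e) * α)
          (hα.add_mul_ne_zero (Or.inl he0) (t := a)) ?_⟩
        rw [hα.resolvent_eq he0, hf]
        simp
    · exact Or.inl ⟨e, w, he0, hf, by rw [polar_comm, hes], hw0, hw2, hw⟩

end QuarticCases

section QuaternionNorm

variable {F : Type} [Field F] {u h : F}

/-- The norm form of the quaternion algebra `[u, h)`, with `i² = u + i` and `j² = h`. -/
noncomputable def quatNorm (u h : F) : QuadraticForm F (QuaternionAlgebra F u 1 h) :=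
  (pf2 F h u).comp (QuaternionAlgebra.linearEquivTuple u 1 h).toLinearMap

theorem quatNorm_apply (x : QuaternionAlgebra F u 1 h) : quatNorm u h x =
    x.re ^ 2 + x.re * x.imI + u * x.imI ^ 2 +
      h * (x.imJ ^ 2 + x.imJ * x.imK + u * x.imK ^ 2) := by
  simp [quatNorm, pf2_apply, QuaternionAlgebra.equivTuple]

variable [CharP F 2]

theorem polar_quatNorm (x y : QuaternionAlgebra F u 1 h) : polar (quatNorm u h) x y =
    x.re * y.imI + x.imI * y.re + h * (x.imJ * y.imK + x.imK * y.imJ) := by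
  simp only [polar, quatNorm_apply, QuaternionAlgebra.re_add, QuaternionAlgebra.imI_add,
    QuaternionAlgebra.imJ_add, QuaternionAlgebra.imK_add]
  grind

theorem quatNorm_mul (x y : QuaternionAlgebra F u 1 h) :
    quatNorm u h (x * y) = quatNorm u h x * quatNorm u h y := by
  simp only [quatNorm_apply, QuaternionAlgebra.re_mul, QuaternionAlgebra.imI_mul,
    QuaternionAlgebra.imJ_mul, QuaternionAlgebra.imK_mul]
  grind

theorem quatNorm_one : quatNorm u h 1 = 1 := by
  simp [quatNorm_apply]

/-- A subspace `F[κ]` and an orthogonal vector `ζ` present the norm form as `⟨⟨N(ζ), N(κ)]]`. -/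
theorem qIsometric_pf2_of_orthogonal {κ ζ : QuaternionAlgebra F u 1 h}
    (hκ : polar (quatNorm u h) 1 κ = 1) (hζ : polar (quatNorm u h) 1 ζ = 0)
    (hκζ : polar (quatNorm u h) κ ζ = 0) (h0 : quatNorm u h ζ ≠ 0) :
    QIsometric F (pf2 F h u) (pf2 F (quatNorm u h ζ) (quatNorm u h κ)) := by
  let H := QuaternionAlgebra F u 1 h
  let f : (Fin 4 → F) →ₗ[F] H :=
    (LinearMap.proj 0).smulRight (1 : H) + (LinearMap.proj 1).smulRight κ +
      (LinearMap.proj 2).smulRight ζ + (LinearMap.proj 3).smulRight (κ * ζ)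
  have hf (x : Fin 4 → F) : f x = x 0 • 1 + x 1 • κ + x 2 • ζ + x 3 • (κ * ζ) := rfl
  have h1 : polar (quatNorm u h) 1 (κ * ζ) = 0 := by
    simp only [polar_quatNorm, QuaternionAlgebra.re_mul, QuaternionAlgebra.imI_mul,
      QuaternionAlgebra.re_one, QuaternionAlgebra.imI_one, QuaternionAlgebra.imJ_one,
      QuaternionAlgebra.imK_one] at hκ hζ hκζ ⊢
    grind
  have h2 : polar (quatNorm u h) κ (κ * ζ) = 0 := by
    simp only [polar_quatNorm, QuaternionAlgebra.re_mul, QuaternionAlgebra.imI_mul,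
      QuaternionAlgebra.imJ_mul, QuaternionAlgebra.imK_mul,
      QuaternionAlgebra.re_one, QuaternionAlgebra.imI_one, QuaternionAlgebra.imJ_one,
      QuaternionAlgebra.imK_one] at hκ hζ hκζ ⊢
    grind
  have h3 : polar (quatNorm u h) ζ (κ * ζ) = quatNorm u h ζ := by
    simp only [polar_quatNorm, quatNorm_apply, QuaternionAlgebra.re_mul,
      QuaternionAlgebra.imI_mul, QuaternionAlgebra.imJ_mul, QuaternionAlgebra.imK_mul,
      QuaternionAlgebra.re_one, QuaternionAlgebra.imI_one, QuaternionAlgebra.imJ_one,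
      QuaternionAlgebra.imK_one] at hκ hζ hκζ ⊢
    grind
  refine QIsometric.symm (qIsometric_of_map (nonsingular_pf2 h0)
    ((QuaternionAlgebra.linearEquivTuple u 1 h).toLinearMap ∘ₗ f) (fun x => ?_) rfl)
  change quatNorm u h (f x) = _
  simp only [hf, QuadraticMap.map_add (quatNorm u h), QuadraticMap.map_smul, polar_add_left,
    polar_smul_left, polar_smul_right, hκ, hζ, hκζ, h1, h2, h3, quatNorm_one, quatNorm_mul,
    pf2_apply, smul_eq_mul]
  ring

end QuaternionNorm

section QuaternionKernel

variable {F : Type} [Field F] [CharP F 2] {E : Type} [Field E] [Algebra F E] {u h : F}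

theorem quatNorm_trace_identity {ρ : QuaternionAlgebra F u 1 h} (hρ : ρ.imI = 0)
    (ω : QuaternionAlgebra F u 1 h) :
    quatNorm u h (ρ * ω + 1) * (ρ * ω + 1).imI +
      ((ρ * ω + 1) * (ω + 1) * star (ρ * ω + 1) * ρ).imI =
      quatNorm u h ρ * ω.imI ^ 2 + (ρ * ω).imI ^ 2 := by
  simp [quatNorm_apply, hρ]
  grind

/-- Coordinatewise extension of scalars of quaternions. -/
def quatMap (E : Type) [Field E] [Algebra F E] (x : QuaternionAlgebra F u 1 h) :
    QuaternionAlgebra E (algebraMap F E u) 1 (algebraMap F E h) :=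
  ⟨algebraMap F E x.re, algebraMap F E x.imI, algebraMap F E x.imJ, algebraMap F E x.imK⟩

theorem quatMap_add (x y : QuaternionAlgebra F u 1 h) :
    quatMap E (x + y) = quatMap E x + quatMap E y := by
  ext <;> simp [quatMap]

theorem quatMap_mul (x y : QuaternionAlgebra F u 1 h) :
    quatMap E (x * y) = quatMap E x * quatMap E y := by
  ext <;> simp [quatMap]

theorem quatMap_one : quatMap E (1 : QuaternionAlgebra F u 1 h) = 1 := by
  ext <;> simp [quatMap]

theorem pf2_coordMap (x : Fin 4 → F) :
    pf2 E (algebraMap F E h) (algebraMap F E u) (coordMap F E 4 x) =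
      algebraMap F E (pf2 F h u x) := by
  simp [pf2_apply, coordMap_apply]

theorem QuarticRel.of_equiv {V W : Type} [AddCommGroup V] [Module F V] [AddCommGroup W] [Module F W]
    {q : QuadraticForm F W} {a b c d : F} {f : V ≃ₗ[F] W} {v₀ v₁ v₂ : V}
    (h : QuarticRel q a b c d (f v₀) (f v₁) (f v₂)) :
    QuarticRel (q.comp f.toLinearMap) a b c d v₀ v₁ v₂ := by
  constructor
  · simpa [polar] using h.h12
  · simpa [polar] using h.h11
  · simpa [polar] using h.h01
  · simpa [polar] using h.h00

variable {a b c d : F} {α : E}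

theorem QuarticRel.map_eq_zero (hα : QuarticRoot a b c d α) {V W : Type} [AddCommGroup V]
    [Module F V] [AddCommGroup W] [Module E W] {q : QuadraticForm F V} {Q : QuadraticForm E W}
    {v₀ v₁ v₂ : V} (h : QuarticRel q a b c d v₀ v₁ v₂) (j : V → W)
    (hj : ∀ v, Q (j v) = algebraMap F E (q v))
    (hj' : ∀ v w, polar Q (j v) (j w) = algebraMap F E (polar q v w)) :
    Q (j v₀ + α • j v₁ + α ^ 2 • j v₂) = 0 := by
  have := hα.charP
  simp only [QuadraticMap.map_add Q, QuadraticMap.map_smul, polar_add_left, polar_smul_left,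
    polar_smul_right, hj, hj', h.h12, h.h11, h.h01, h.h00, smul_eq_mul, map_add, map_mul]
  linear_combination algebraMap F E (q v₂) * hα.root + α ^ 2 * algebraMap F E (polar q v₀ v₂) *
    CharTwo.two_eq_zero (R := E)

theorem QuarticRoot.quarticRel_quatNorm (hα : QuarticRoot a b c d α)
    {σ τ : QuaternionAlgebra F u 1 h}
    (hz : quatNorm (algebraMap F E u) (algebraMap F E h)
      (quatMap E τ + α • quatMap E σ + α ^ 2 • 1) = 0) :
    QuarticRel (quatNorm u h) a b c d τ σ 1 := by
  refine QuarticRel.of_equiv (hα.quarticRel (Q := pf2 E (algebraMap F E h) (algebraMap F E u))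
    pf2_coordMap ?_)
  rw [← hz, quatNorm_apply, pf2_apply]
  simp [coordMap_apply, quatMap, QuaternionAlgebra.equivTuple]

theorem quatNorm_quatMap (x : QuaternionAlgebra F u 1 h) :
    quatNorm (algebraMap F E u) (algebraMap F E h) (quatMap E x) =
      algebraMap F E (quatNorm u h x) := by
  simp [quatNorm_apply, quatMap]

theorem polar_quatMap (x y : QuaternionAlgebra F u 1 h) :
    polar (quatNorm (algebraMap F E u) (algebraMap F E h)) (quatMap E x) (quatMap E y) =
      algebraMap F E (polar (quatNorm u h) x y) := by
  simp only [polar, ← quatMap_add, quatNorm_quatMap, map_sub]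

theorem star_mul_self_eq (p : QuaternionAlgebra F u 1 h) :
    star p * p = quatNorm u h p • 1 := by
  ext <;> simp [quatNorm_apply] <;> grind

/-- Conjugating the polynomial `X² + σX + τ` of vanishing linear trace by a linear factor produces
one with `tr τ' ≠ 0`. -/
theorem QuarticRel.exists_polar_ne_zero (hα : QuarticRoot a b c d α)
    (han : (quatNorm u h).Anisotropic)
    {σ τ : QuaternionAlgebra F u 1 h} (hr : QuarticRel (quatNorm u h) a b c d τ σ 1)
    (hτ : polar (quatNorm u h) τ 1 = 0) (hδ : a ^ 2 * d + c ^ 2 ≠ 0) :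
    ∃ σ' τ' : QuaternionAlgebra F u 1 h, QuarticRel (quatNorm u h) a b c d τ' σ' 1 ∧
      polar (quatNorm u h) τ' 1 ≠ 0 := by
  have hE := hα.charP
  set N := quatNorm u h with hN
  set κ := σ + τ + 1 with hκ
  set p := κ * κ + σ * κ + τ with hp
  have hτ' : τ.imI = 0 := by simpa [N, polar_quatNorm] using hτ
  have hp' : p = (1 + τ) * (σ + τ) + 1 := by
    ext <;> simp [p, κ] <;> grind
  have hid := quatNorm_trace_identity (u := u) (h := h) (ρ := 1 + τ) (by simp [hτ']) (σ + τ)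
  rw [← hp'] at hid
  have hval : quatNorm u h (1 + τ) * (σ + τ).imI ^ 2 + ((1 + τ) * (σ + τ)).imI ^ 2 =
      a ^ 2 * d + c ^ 2 := by
    have h1 := hr.h12
    have h2 := hr.h01
    have h3 := hr.h00
    simp [N, polar_quatNorm, quatNorm_apply, hτ'] at h1 h2 h3 ⊢
    grind
  rw [hval] at hid
  have hNp : N p ≠ 0 := by
    intro h0
    rw [han _ h0] at hid
    exact hδ (by simpa using hid.symm)
  set κ' := (N p)⁻¹ • (p * κ * star p) with hκ'
  have hκp : κ' * p = p * κ := by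
    rw [hκ', smul_mul_assoc, mul_assoc, star_mul_self_eq, ← hN, mul_smul_comm, mul_one,
      inv_smul_smul₀ hNp]
  set σ' := σ + κ - κ' with hσ'
  set τ' := τ - κ' * σ + σ' * κ with hτ''
  have hcomm : τ' * κ = κ' * τ := by
    have : τ' * κ - κ' * τ = p * κ - κ' * p := by
      simp only [hτ'', hσ', hp]
      noncomm_ring
    rwa [hκp, sub_self, sub_eq_zero] at this
  refine ⟨σ', τ', hα.quarticRel_quatNorm ?_, ?_⟩
  · have hM := hr.map_eq_zero hα (quatMap E) quatNorm_quatMap polar_quatMap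
    rw [quatMap_one] at hM
    set m : QuaternionAlgebra F u 1 h → _ := quatMap E
    have e₁ : m σ' + m κ' = m σ + m κ := by
      rw [← quatMap_add, ← quatMap_add, hσ', sub_add_cancel]
    have e₂ : m τ' + m κ' * m σ = m τ + m σ' * m κ := by
      simp only [m, ← quatMap_add, ← quatMap_mul]
      rw [hτ'']
      congr 1
      abel
    have e₃ : m τ' * m κ = m κ' * m τ := by
      simp only [m, ← quatMap_mul, hcomm]
    have key : (m τ' + α • m σ' + α ^ 2 • 1) * (α • 1 - m κ) =
        (α • 1 - m κ') * (m τ + α • m σ + α ^ 2 • 1) := by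
      have z₁ : m σ' + m κ' - m σ - m κ = 0 := by rw [e₁]; abel
      have z₂ : m τ' + m κ' * m σ - m τ - m σ' * m κ = 0 := by rw [e₂]; abel
      have : (m τ' + α • m σ' + α ^ 2 • 1) * (α • 1 - m κ) -
          (α • 1 - m κ') * (m τ + α • m σ + α ^ 2 • 1) =
          α ^ 2 • (m σ' + m κ' - m σ - m κ) +
          α • (m τ' + m κ' * m σ - m τ - m σ' * m κ) + (m κ' * m τ - m τ' * m κ) := by
        simp only [mul_add, add_mul, mul_sub, sub_mul, smul_mul_assoc, mul_smul_comm, mul_one,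
          one_mul]
        module
      rw [← sub_eq_zero, this, z₁, z₂, e₃]
      simp
    have hk : quatNorm (algebraMap F E u) (algebraMap F E h) (α • 1 - m κ) ≠ 0 := by
      intro h0
      have : algebraMap F E (quatNorm u h κ) + algebraMap F E κ.imI * α +
          algebraMap F E 1 * α ^ 2 + algebraMap F E 0 * α ^ 3 = 0 := by
        rw [← h0]
        simp [quatNorm_apply, m, quatMap]
        grind
      exact one_ne_zero (hα.indep _ _ _ _ this).2.2.1
    have := congrArg (quatNorm (algebraMap F E u) (algebraMap F E h)) key
    rw [quatNorm_mul, quatNorm_mul, hM, mul_zero] at this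
    exact (mul_eq_zero.1 this).resolve_right hk
  · have h1 : N p • τ' = N p • p - p * κ * star p * (1 + τ) := by
      have : τ' = p - κ' * (1 + τ) := by
        have hσκ : σ + κ - κ' + κ' = 1 + τ := by
          rw [sub_add_cancel]
          ext <;> simp [κ] <;> grind
        rw [← hσκ, hτ'', hσ', hp]
        noncomm_ring
      rw [this, smul_sub, hκ', smul_mul_assoc, smul_inv_smul₀ hNp]
    have h2 : N p * τ'.imI = a ^ 2 * d + c ^ 2 := by
      have := congrArg QuaternionAlgebra.imI h1
      simp only [QuaternionAlgebra.imI_smul, QuaternionAlgebra.imI_sub, smul_eq_mul] at this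
      rw [this, ← hid]
      grind
    intro h0
    have h3 : τ'.imI = 0 := by simpa [N, polar_quatNorm] using h0
    rw [h3, mul_zero] at h2
    exact hδ h2.symm

end QuaternionKernel

section PfisterKernel

variable {F : Type} [Field F] [CharP F 2] {E : Type} [Field E] [Algebra F E] {u h : F}

theorem eq_zero_of_binary_eq_zero {x y : F} (hu : ∀ t : F, t ^ 2 + t + u ≠ 0)
    (hxy : x ^ 2 + x * y + u * y ^ 2 = 0) : x = 0 ∧ y = 0 := by
  by_cases hy : y = 0
  · subst hy
    simpa using hxy
  · exact absurd (artinSchreier_root_of_isotropic hy hxy) (hu _)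

theorem qIsometric_pf2_one_of_isotropic (hu : ∀ t : F, t ^ 2 + t + u ≠ 0) (hh : h ≠ 0)
    {x : Fin 4 → F} (hx0 : x ≠ 0) (hx : pf2 F h u x = 0) :
    QIsometric F (pf2 F h u) (pf2 F 1 u) := by
  rw [pf2_apply] at hx
  set n := x 0 ^ 2 + x 0 * x 1 + u * x 1 ^ 2 with hn
  have hn0 : n ≠ 0 := by
    intro h0
    obtain ⟨h1, h2⟩ := eq_zero_of_binary_eq_zero hu h0
    rw [h0, zero_add, mul_eq_zero, or_iff_right hh] at hx
    obtain ⟨h3, h4⟩ := eq_zero_of_binary_eq_zero hu hx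
    refine hx0 (funext fun i => ?_)
    fin_cases i <;> assumption
  have key := qIsometric_pf2_of_orthogonal (u := u) (h := h) (κ := ⟨0, 1, 0, 0⟩)
    (ζ := ⟨0, 0, (x 2 * (x 0 + x 1) + u * x 3 * x 1) / n, (x 2 * x 1 + x 3 * x 0) / n⟩)
  have h1 : quatNorm u h
      ⟨0, 0, (x 2 * (x 0 + x 1) + u * x 3 * x 1) / n, (x 2 * x 1 + x 3 * x 0) / n⟩ = 1 := by
    simp only [quatNorm_apply]
    field_simp
    grind
  rw [h1] at key
  have h2 : quatNorm u h ⟨0, 1, 0, 0⟩ = u := by simp [quatNorm_apply]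
  rw [h2] at key
  exact key (by simp [polar_quatNorm]) (by simp [polar_quatNorm]) (by simp [polar_quatNorm])
    one_ne_zero

theorem nonsingular_quatNorm (hh : h ≠ 0) : Nonsingular F (quatNorm u h) := by
  intro x hx
  let g := QuaternionAlgebra.linearEquivTuple u 1 h
  refine g.map_eq_zero_iff.1 (nonsingular_pf2 hh (h := u) _ fun y => ?_)
  rw [← g.apply_symm_apply y, ← hx (g.symm y)]
  simp only [polar, quatNorm, QuadraticMap.comp_apply, LinearEquiv.coe_coe, map_add, g]

instance : FiniteDimensional F (QuaternionAlgebra F u 1 h) :=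
  (QuaternionAlgebra.linearEquivTuple u 1 h).symm.finiteDimensional

theorem finrank_quaternion : Module.finrank F (QuaternionAlgebra F u 1 h) = 4 := by
  rw [(QuaternionAlgebra.linearEquivTuple u 1 h).finrank_eq]
  simp

variable {a b c d : F} {α : E}

theorem QuarticRoot.exists_quarticRel_quatNorm (hα : QuarticRoot a b c d α)
    (hu : ∀ β : E, β ^ 2 + β + algebraMap F E u ≠ 0)
    (han : (pf2 F h u).Anisotropic) {z : Fin 4 → E} (hz0 : z ≠ 0)
    (hz : pf2 E (algebraMap F E h) (algebraMap F E u) z = 0) :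
    ∃ σ τ : QuaternionAlgebra F u 1 h, QuarticRel (quatNorm u h) a b c d τ σ 1 := by
  have hE := hα.charP
  let H := QuaternionAlgebra E (algebraMap F E u) 1 (algebraMap F E h)
  let f : H ≃ₗ[E] (Fin 4 → E) := QuaternionAlgebra.linearEquivTuple _ _ _
  let ω : H := f.symm z
  let i : H := ⟨0, 1, 0, 0⟩
  have hi (t : E) : quatNorm (algebraMap F E u) (algebraMap F E h)
      ((⟨0, 1, 0, 0⟩ : QuaternionAlgebra E _ 1 _) - t • 1) = t ^ 2 + t + algebraMap F E u := by
    simp [quatNorm_apply]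
    grind
  have hω : quatNorm (algebraMap F E u) (algebraMap F E h) ω = 0 := by
    simpa [quatNorm, ω, f] using hz
  have hω0 : ω ≠ 0 := by simpa [ω] using hz0
  have hli : LinearIndependent E ![ω, i * ω] := by
    refine (LinearIndependent.pair_iff' hω0).2 fun t ht => ?_
    have h1 : (i - t • 1) * ω = 0 := by
      rw [sub_mul, ← ht, smul_mul_assoc, one_mul, sub_self]
    have h2 : star (i - t • 1) * ((i - t • 1) * ω) = 0 := by rw [h1, mul_zero]
    rw [← mul_assoc, star_mul_self_eq, smul_mul_assoc, one_mul, smul_eq_zero, or_iff_left hω0]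
      at h2
    exact hu t ((hi t).symm.trans h2)
  obtain ⟨S, T, hST⟩ := hα.exists_operators (q := pf2 F h u) pf2_coordMap han
    (L := (Submodule.span E (Set.range ![ω, i * ω])).map f.toLinearMap)
    (by
      rw [LinearEquiv.finrank_map_eq, finrank_span_eq_card hli]
      simp)
    (by
      rintro _ ⟨y, hy, rfl⟩
      rw [Matrix.range_cons_cons_empty, SetLike.mem_coe, Submodule.mem_span_pair] at hy
      obtain ⟨s, t, rfl⟩ := hy
      change quatNorm (algebraMap F E u) (algebraMap F E h) (s • ω + t • (i * ω)) = 0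
      have : s • ω + t • (i * ω) = (s • 1 + t • i) * ω := by
        rw [add_mul, smul_mul_assoc, smul_mul_assoc, one_mul]
      rw [this, quatNorm_mul, hω, mul_zero])
  let g := QuaternionAlgebra.linearEquivTuple u 1 h
  refine ⟨g.symm (S (g 1)), g.symm (T (g 1)), QuarticRel.of_equiv (f := g) ?_⟩
  simpa using hST (g 1)

/-- An anisotropic 2-fold Pfister form with a quaternion satisfying the isotropy relations has one
of the three distinguished presentations, unless the linear trace vanishes. -/
theorem QuarticRel.exists_isKernelPf2 (hα : QuarticRoot a b c d α) (hh : h ≠ 0)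
    (han : (quatNorm u h).Anisotropic) {σ τ : QuaternionAlgebra F u 1 h}
    (hr : QuarticRel (quatNorm u h) a b c d τ σ 1) :
    (∃ π, IsKernelPf2 F E a b c d π ∧ QIsometric F (pf2 F h u) π) ∨
      (polar (quatNorm u h) τ 1 = 0 ∧ a ^ 2 * d + c ^ 2 ≠ 0) := by
  have h1 : (1 : QuaternionAlgebra F u 1 h) ≠ 0 := one_ne_zero
  have hns : Nonsingular F (quatNorm u h) := nonsingular_quatNorm hh
  rcases hr.cases hα han h1 with ⟨e, w, he, hf, h20, hw0, hw2, hw⟩ | ⟨p, g, hp, hpg, hβ⟩ |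
    ⟨ζ, g, hli, hζ, hζg, hγ⟩ | h4 | ⟨ha, hc, h02, hli⟩
  · refine Or.inl ⟨_, Or.inr (Or.inr ⟨e, he, hf, rfl⟩), ?_⟩
    have key := qIsometric_pf2_of_orthogonal (κ := e⁻¹ • τ) (ζ := e • w)
      (by rw [polar_smul_right, h20, quatNorm_one, mul_one, smul_eq_mul, inv_mul_cancel₀ he])
      (by rw [polar_smul_right, polar_comm, hw2, smul_zero])
      (by rw [polar_smul_right, polar_smul_left, polar_comm, hw0, smul_zero, smul_zero])
    have e1 : quatNorm u h (e • w) = cubicResolvent F a b c d e := by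
      rw [QuadraticMap.map_smul, hw, quatNorm_one, smul_eq_mul]
      field_simp
    have e2 : quatNorm u h (e⁻¹ • τ) = d / e ^ 2 := by
      rw [QuadraticMap.map_smul, hr.h00, quatNorm_one, smul_eq_mul]
      field_simp
    rw [e1, e2] at key
    exact key hf
  · obtain ⟨ζ, hζ0, hζ⟩ := exists_ne_zero_polar_eq_zero (quatNorm u h) ![1, p]
      (by rw [finrank_quaternion]; simp)
    have hN : quatNorm u h ζ ≠ 0 := fun h0 => hζ0 (han _ h0)
    rw [quatNorm_one, one_mul] at hpg
    rw [quatNorm_one] at hp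
    refine Or.inl ⟨_, Or.inl ⟨_, _, hN, hβ, rfl⟩, ?_⟩
    rw [← hpg]
    exact qIsometric_pf2_of_orthogonal hp (by simpa [polar_comm _ ζ] using hζ 0)
      (by simpa [polar_comm _ ζ] using hζ 1) hN
  · obtain ⟨κ, hκ⟩ := hns.exists_polar_eq hli ![1, 0]
    rw [quatNorm_one, one_mul] at hζg
    have hN : g ≠ 0 := by
      rintro rfl
      exact hli.ne_zero 1 (han _ hζg)
    subst hζg
    refine Or.inl ⟨_, Or.inr (Or.inl ⟨_, quatNorm u h κ, hN, hγ, rfl⟩), ?_⟩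
    exact qIsometric_pf2_of_orthogonal (by simpa [polar_comm _ κ] using hκ 0) hζ
      (by simpa using hκ 1) hN
  · exact Or.inr h4
  · have h12 : polar (quatNorm u h) σ 1 = 0 := by rw [hr.h12, ha, zero_mul]
    have h01 : polar (quatNorm u h) τ σ = 0 := by rw [hr.h01, hc, zero_mul]
    have := hns.two_mul_card_le hli (fun i j => by
      fin_cases i <;> fin_cases j <;>
        simp [-polar_self, polar_self_eq_zero, h12, h01, h02, polar_comm _ σ τ, polar_comm _ 1 σ,
          polar_comm _ 1 τ])
    rw [finrank_quaternion, Fintype.card_fin] at this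
    omega

/-- A 2-fold Pfister form that becomes isotropic over a simple quartic extension is isometric to one
of the distinguished ones. -/
theorem QuarticRoot.exists_isKernelPf2 (hα : QuarticRoot a b c d α) (hh : h ≠ 0)
    {z : Fin 4 → E} (hz0 : z ≠ 0)
    (hz : pf2 E (algebraMap F E h) (algebraMap F E u) z = 0) :
    ∃ π, IsKernelPf2 F E a b c d π ∧ QIsometric F (pf2 F h u) π := by
  by_cases hu : ∃ β : E, β ^ 2 + β + algebraMap F E u = 0
  · exact ⟨_, Or.inl ⟨h, u, hh, hu, rfl⟩, ⟨QuadraticMap.IsometryEquiv.refl _⟩⟩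
  push Not at hu
  by_cases han : (pf2 F h u).Anisotropic
  · obtain ⟨σ, τ, hr⟩ := hα.exists_quarticRel_quatNorm hu han hz0 hz
    have han' : (quatNorm u h).Anisotropic := fun x hx =>
      (QuaternionAlgebra.linearEquivTuple u 1 h).map_eq_zero_iff.1 (han _ hx)
    rcases hr.exists_isKernelPf2 hα hh han' with h1 | ⟨h1, h2⟩
    · exact h1
    · obtain ⟨σ', τ', hr', h3⟩ := hr.exists_polar_ne_zero hα han' h1 h2
      exact (hr'.exists_isKernelPf2 hα hh han').resolve_right fun h4 => h3 h4.1
  · simp only [QuadraticMap.Anisotropic, not_forall] at han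
    obtain ⟨x, hx, hx0⟩ := han
    refine ⟨_, Or.inr (Or.inl ⟨1, u, one_ne_zero, ⟨1, by simp⟩, rfl⟩),
      qIsometric_pf2_one_of_isotropic (fun t ht => hu (algebraMap F E t) ?_) hh hx0 hx⟩
    rw [← map_pow, ← map_add, ← map_add, ht, map_zero]

end PfisterKernel

section SplitTriple

variable {F : Type} [Field F] [CharP F 2] {E : Type} [Field E] [Algebra F E] {a b c d : F} {α : E}
  {V : Type} [AddCommGroup V] [Module F V] {q : QuadraticForm F V}

/-- A nonsingular plane `q(p₁)[1,u]` together with an orthogonal vector `p₃` of value `q(p₁) h`,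
such that `h` is represented by `[1,u]` over `E`. -/
structure SplitTriple (E : Type) [Field E] [Algebra F E] (q : QuadraticForm F V) (u h : F)
    (p₁ p₂ p₃ : V) : Prop where
  ne_zero : q p₁ ≠ 0
  h12 : polar q p₁ p₂ = q p₁
  h2 : q p₂ = q p₁ * u
  h3 : q p₃ = q p₁ * h
  h13 : polar q p₁ p₃ = 0
  h23 : polar q p₂ p₃ = 0
  hh : h ≠ 0
  split : ∃ x y : E, x ^ 2 + x * y + algebraMap F E u * y ^ 2 = algebraMap F E h

theorem QuarticRel.splitTriple_of_ne_zero (hα : QuarticRoot a b c d α) (han : q.Anisotropic)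
    {v₀ v₁ v₂ : V} (hr : QuarticRel q a b c d v₀ v₁ v₂) (h02 : polar q v₀ v₂ = 0) (h2 : v₂ ≠ 0)
    (hδ : a ^ 2 * d + c ^ 2 ≠ 0) : ∃ u h p₁ p₂ p₃, SplitTriple E q u h p₁ p₂ p₃ := by
  have := hα.charP
  have hs : q v₂ ≠ 0 := fun h0 => h2 (han _ h0)
  have hα0 := hα.ne_zero
  have hroot := hα.root
  have h11 : q v₁ = b * q v₂ := by rw [hr.h11, h02, add_zero]
  by_cases ha : a = 0
  · subst ha
    have hc : c ≠ 0 := by rintro rfl; simp at hδ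
    have hc' : algebraMap F E c ≠ 0 := by simpa using hc
    have hv1 : v₁ ≠ 0 := by
      rintro rfl
      exact mul_ne_zero hc hs (by simpa using hr.h01.symm)
    have hb : b ≠ 0 := by
      rintro rfl
      exact hv1 (han _ (by rw [h11, zero_mul]))
    have hb' : algebraMap F E b ≠ 0 := by simpa using hb
    refine ⟨b * d / c ^ 2, b⁻¹, v₁, (b / c) • v₀, v₂, ?_, ?_, ?_, ?_, ?_, ?_, inv_ne_zero hb,
      α⁻¹, algebraMap F E c / (algebraMap F E b * α ^ 2), ?_⟩
    · rw [h11]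
      exact mul_ne_zero hb hs
    · rw [polar_smul_right, polar_comm, hr.h01, h11, smul_eq_mul]
      field_simp
    · rw [QuadraticMap.map_smul, hr.h00, h11, smul_eq_mul]
      field_simp
    · rw [h11]
      field_simp
    · rw [hr.h12, zero_mul]
    · rw [polar_smul_left, h02, smul_zero]
    · simp only [map_div₀, map_mul, map_pow, map_inv₀, map_zero] at hroot ⊢
      field_simp
      grind
  · have ha' : algebraMap F E a ≠ 0 := by simpa using ha
    refine ⟨b / a ^ 2, a ^ 2 * d + c ^ 2, v₂, a⁻¹ • v₁, c • v₂ + a • v₀, hs, ?_, ?_, ?_, ?_, ?_,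
      hδ, algebraMap F E c + algebraMap F E a * α ^ 2, algebraMap F E a ^ 2 * α, ?_⟩
    · rw [polar_smul_right, polar_comm, hr.h12, smul_eq_mul, inv_mul_cancel_left₀ ha]
    · rw [QuadraticMap.map_smul, h11, smul_eq_mul]
      field_simp
    · simp only [QuadraticMap.map_add q, QuadraticMap.map_smul, polar_smul_left, polar_smul_right,
        polar_comm q v₂ v₀, h02, hr.h00, smul_eq_mul]
      ring
    · simp only [polar_add_right, polar_smul_right, polar_self_eq_zero, polar_comm q v₂ v₀, h02,
        smul_zero, add_zero]
    · simp only [polar_add_right, polar_smul_right, polar_smul_left, polar_comm q v₁ v₀, hr.h12,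
        hr.h01, smul_eq_mul]
      grind
    · simp only [map_div₀, map_mul, map_pow, map_add]
      field_simp
      grind

theorem totallySingular_of_operators {b d : F} {S T : V →ₗ[F] V}
    (hST : ∀ v, QuarticRel q 0 b 0 d (T v) (S v) v) (hT : ∀ v, polar q (T v) v = 0) (v : V) :
    (∀ i j, polar q (![S (T v), S v, v, T v] i) (![S (T v), S v, v, T v] j) = 0) ∧
      q (S v) = b * q v ∧ q (S (T v)) = b * (d * q v) := by
  have h12 (v) : polar q (S v) v = 0 := by rw [(hST v).h12, zero_mul]
  have h01 (v) : polar q (T v) (S v) = 0 := by rw [(hST v).h01, zero_mul]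
  have h11 (v) : q (S v) = b * q v := by rw [(hST v).h11, hT, add_zero]
  have hS (v w) : polar q (S v) w = polar q v (S w) := by
    have := h12 (v + w)
    simp only [map_add, polar_add_left, polar_add_right, h12, polar_comm q (S w) v] at this
    grind
  have hSS (v w) : polar q (S v) (S w) = b * polar q v w := by
    simp only [polar, ← map_add, h11]
    ring
  refine ⟨fun i j => ?_, h11 v, by rw [h11, (hST v).h00]⟩
  have e1 : polar q (S (T v)) (S v) = 0 := by rw [hSS, hT, mul_zero]
  have e2 : polar q (S (T v)) v = 0 := by rw [hS, h01]
  fin_cases i <;> fin_cases j <;>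
    simp [-polar_self, polar_self_eq_zero, e1, e2, h12, h01, hT, polar_comm q (S v) (S (T v)),
      polar_comm q v (S (T v)), polar_comm q (T v) (S (T v)), polar_comm q v (S v),
      polar_comm q (S v) (T v), polar_comm q v (T v)]

theorem linearIndependent_of_operators {b d : F} (han : q.Anisotropic) {S T : V →ₗ[F] V}
    (hST : ∀ v, QuarticRel q 0 b 0 d (T v) (S v) v) (hT : ∀ v, polar q (T v) v = 0) {v : V}
    (hv : LinearIndependent F ![S v, v, T v]) :
    LinearIndependent F ![S (T v), S v, v, T v] := by
  refine linearIndependent_finCons.2 ⟨hv, fun hmem => ?_⟩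
  have h00 := (hST v).h00
  obtain ⟨h0, h1, h2⟩ := totallySingular_of_operators hST hT v
  have hs : q v ≠ 0 := fun h => hv.ne_zero 1 (han _ h)
  have h12 : polar q (S v) v = 0 := h0 1 2
  have h13 : polar q (S v) (T v) = 0 := h0 1 3
  have h23 : polar q v (T v) = 0 := h0 2 3
  have hval (x y w : F) : q (x • S v + (y • v + w • T v)) =
      (b * x ^ 2 + y ^ 2 + d * w ^ 2) * q v := by
    simp only [QuadraticMap.map_add q, QuadraticMap.map_smul, polar_add_right, polar_smul_left,
      polar_smul_right, h12, h13, h23, h1, h00, smul_eq_mul]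
    ring
  have hind (x y w : F) (h : b * x ^ 2 + y ^ 2 + d * w ^ 2 = 0) : x = 0 ∧ y = 0 ∧ w = 0 := by
    have hz : x • S v + (y • v + w • T v) = 0 := han _ (by rw [hval, h, zero_mul])
    have := Fintype.linearIndependent_iff.1 hv ![x, y, w]
      (by simpa [Fin.sum_univ_three, add_assoc] using hz)
    exact ⟨this 0, this 1, this 2⟩
  have hset : Set.range ![S v, v, T v] = {S v, v, T v} := by
    simp only [Matrix.range_cons, Matrix.range_empty, Set.singleton_union, Set.union_empty]
  rw [hset, Submodule.mem_span_triple] at hmem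
  obtain ⟨y, x, w, hm⟩ := hmem
  have hbd : b * d = b * y ^ 2 + x ^ 2 + d * w ^ 2 := by
    rw [add_assoc] at hm
    rw [← hm, hval] at h2
    refine mul_right_cancel₀ hs ?_
    linear_combination -h2
  have hd : d + y ^ 2 ≠ 0 := fun h => one_ne_zero (hind 0 y 1 (by linear_combination h)).2.2
  refine one_ne_zero (hind 1 ((x * y + w * d) / (d + y ^ 2)) ((x + w * y) / (d + y ^ 2)) ?_).1
  field_simp
  grind

variable [FiniteDimensional F V]

theorem QuarticRoot.exists_splitTriple (hα : QuarticRoot a b c d α) (han : q.Anisotropic)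
    (hns : Nonsingular F q) (hdim : Module.finrank F V = 6) {S T : V →ₗ[F] V}
    (hST : ∀ v, QuarticRel q a b c d (T v) (S v) v) :
    ∃ u h p₁ p₂ p₃, SplitTriple E q u h p₁ p₂ p₃ := by
  have hcases (v : V) (hv : v ≠ 0) : (∃ u h p₁ p₂ p₃, SplitTriple E q u h p₁ p₂ p₃) ∨
      (a = 0 ∧ c = 0 ∧ polar q (T v) v = 0 ∧ LinearIndependent F ![S v, v, T v]) := by
    have := hα.charP
    have hs : q v ≠ 0 := fun h0 => hv (han _ h0)
    rcases (hST v).cases hα han hv with ⟨e, w, he, hf, h20, hw0, hw2, hw⟩ |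
      ⟨p, g, hp, hpg, β, hβ⟩ | ⟨ζ, g, hli, hζ, hζg, γ, hγ⟩ | ⟨h02, hδ⟩ | h5
    · refine Or.inl ⟨d / e ^ 2, cubicResolvent F a b c d e / e ^ 2, v, e⁻¹ • T v, w, hs, ?_, ?_,
        hw, by rw [polar_comm, hw2], by rw [polar_smul_left, polar_comm, hw0, smul_zero],
        div_ne_zero hf (pow_ne_zero 2 he), hα.split_resolvent he⟩
      · rw [polar_smul_right, h20, smul_eq_mul, inv_mul_cancel_left₀ he]
      · rw [QuadraticMap.map_smul, (hST v).h00, smul_eq_mul]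
        field_simp
    · obtain ⟨ζ, hζ0, hζ⟩ := exists_ne_zero_polar_eq_zero q ![v, p] (by rw [hdim]; simp)
      have hN : q ζ ≠ 0 := fun h0 => hζ0 (han _ h0)
      refine Or.inl ⟨g, q ζ / q v, v, p, ζ, hs, hp, hpg, (mul_div_cancel₀ _ hs).symm,
        by simpa [polar_comm _ ζ] using hζ 0, by simpa [polar_comm _ ζ] using hζ 1,
        div_ne_zero hN hs, ?_⟩
      generalize algebraMap F E (q ζ / q v) = k
      refine ⟨k + β * (k + 1), k + 1, ?_⟩
      grind
    · obtain ⟨κ, hκ⟩ := hns.exists_polar_eq hli ![q v, 0]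
      have hg : g ≠ 0 := by
        rintro rfl
        exact hli.ne_zero 1 (han _ (by simpa using hζg))
      exact Or.inl ⟨q κ / q v, g, v, κ, ζ, hs, by simpa [polar_comm _ κ] using hκ 0,
        (mul_div_cancel₀ _ hs).symm, hζg, hζ, by simpa using hκ 1, hg, γ, 0, by simp [hγ]⟩
    · exact Or.inl ((hST v).splitTriple_of_ne_zero hα han h02 hv hδ)
    · exact Or.inr h5
  have : Nontrivial V := Module.nontrivial_of_finrank_pos (R := F) (by omega)
  obtain ⟨v, hv⟩ := exists_ne (0 : V)
  refine (hcases v hv).elim id ?_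
  rintro ⟨rfl, rfl, -, hli⟩
  by_contra hno
  have hT (w : V) : polar q (T w) w = 0 := by
    by_cases hw : w = 0
    · simp [hw]
    · exact ((hcases w hw).resolve_left hno).2.2.1
  have := hns.two_mul_card_le (linearIndependent_of_operators han hST hT hli)
    (totallySingular_of_operators hST hT v).1
  simp [hdim] at this

end SplitTriple

section AdaptedFamily

variable {F : Type} [Field F] {V : Type} [AddCommGroup V] [Module F V] {q : QuadraticForm F V}

theorem Nonsingular.exists_polar_eq_one (hns : Nonsingular F q) {v : V} (hv : v ≠ 0) :
    ∃ y, polar q v y = 1 := by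
  by_contra! hno
  refine hv (hns v fun y => ?_)
  by_contra hy
  exact hno ((polar q v y)⁻¹ • y) (by rw [polar_smul_right, smul_eq_mul, inv_mul_cancel₀ hy])

/-- A symplectic basis exhibiting a 6-dimensional form as
`s([1,u] ⊥ h[1,w] ⊥ t[1,r])`. -/
structure AdaptedFamily (q : QuadraticForm F V) (s h t u w r : F) (e f : Fin 3 → V) : Prop where
  sympl : SymplecticFamily q e f
  hs : s ≠ 0
  hh : h ≠ 0
  ht : t ≠ 0
  e0 : q (e 0) = s
  f0 : s * q (f 0) = u
  e1 : q (e 1) = s * h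
  f1 : s * h * q (f 1) = w
  e2 : q (e 2) = s * t
  f2 : s * t * q (f 2) = r

variable {s h t u w r : F} {e f : Fin 3 → V}

theorem AdaptedFamily.arfSum_eq (hA : AdaptedFamily q s h t u w r e f) :
    arfSum q e f = u + w + r := by
  rw [arfSum, Fin.sum_univ_three, hA.e0, hA.e1, hA.e2, hA.f0, hA.f1, hA.f2]

theorem AdaptedFamily.map_combination (hA : AdaptedFamily q s h t u w r e f)
    (x₀ y₀ x₁ y₁ x₂ y₂ : F) :
    q (x₀ • e 0 + (y₀ * s) • f 0 + (x₁ • e 1 + (y₁ * (s * h)) • f 1) +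
      (x₂ • e 2 + (y₂ * (s * t)) • f 2)) =
    s * (x₀ ^ 2 + x₀ * y₀ + u * y₀ ^ 2 + h * (x₁ ^ 2 + x₁ * y₁ + w * y₁ ^ 2) +
      t * (x₂ ^ 2 + x₂ * y₂ + r * y₂ ^ 2)) := by
  have hs := hA.sympl
  simp only [QuadraticMap.map_add q, QuadraticMap.map_smul, polar_add_left, polar_add_right,
    polar_smul_left, polar_smul_right, hs.left, hs.right, hs.pair, hs.polar_right, hA.e0, hA.e1,
    hA.e2, smul_eq_mul]
  simp
  rw [← hA.f0, ← hA.f1, ← hA.f2]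
  ring

theorem AdaptedFamily.coordMap_family {E : Type} [Field E] [Algebra F E] {n : ℕ} {q : QF F n}
    {e f : Fin 3 → Fin n → F} {Q : QF E n}
    (hA : AdaptedFamily q s h t u w r e f)
    (hQ : ∀ v, Q (coordMap F E n v) = algebraMap F E (q v)) :
    AdaptedFamily Q (algebraMap F E s) (algebraMap F E h) (algebraMap F E t) (algebraMap F E u)
      (algebraMap F E w) (algebraMap F E r) (fun i => coordMap F E n (e i))
      (fun i => coordMap F E n (f i)) where
  sympl := by
    constructor <;> intro i j <;> rw [polar_coordMap hQ]
    · rw [hA.sympl.left, map_zero]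
    · rw [hA.sympl.right, map_zero]
    · rw [hA.sympl.pair]
      split_ifs <;> simp
  hs := by simpa using hA.hs
  hh := by simpa using hA.hh
  ht := by simpa using hA.ht
  e0 := by rw [hQ, hA.e0]
  f0 := by rw [hQ, ← map_mul, hA.f0]
  e1 := by rw [hQ, ← map_mul, hA.e1]
  f1 := by rw [hQ, ← map_mul, ← map_mul, hA.f1]
  e2 := by rw [hQ, ← map_mul, hA.e2]
  f2 := by rw [hQ, ← map_mul, ← map_mul, hA.f2]

variable [CharP F 2] [FiniteDimensional F V]

theorem SplitTriple.exists_adaptedFamily {E : Type} [Field E] [Algebra F E] {p₁ p₂ p₃ : V}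
    (hp : SplitTriple E q u h p₁ p₂ p₃) (han : q.Anisotropic) (hns : Nonsingular F q)
    (hdim : Module.finrank F V = 6) :
    ∃ (s t w r : F) (e f : Fin 3 → V), AdaptedFamily q s h t u w r e f := by
  have hs := hp.ne_zero
  obtain ⟨f₀, hf₀⟩ : ∃ f₀, f₀ = (q p₁)⁻¹ • p₂ := ⟨_, rfl⟩
  have h00 : polar q p₁ f₀ = 1 := by
    rw [hf₀, polar_smul_right, hp.h12, smul_eq_mul, inv_mul_cancel₀ hs]
  have h01 : polar q f₀ p₃ = 0 := by rw [hf₀, polar_smul_left, hp.h23, smul_zero]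
  have hqf₀ : q p₁ * q f₀ = u := by
    rw [hf₀, QuadraticMap.map_smul, hp.h2, smul_eq_mul]
    field_simp
  have hp3 : p₃ ≠ 0 := by
    rintro rfl
    exact mul_ne_zero hs hp.hh (by simpa using hp.h3.symm)
  obtain ⟨y₁, hy₁⟩ := hns.exists_polar_eq_one hp3
  obtain ⟨f₁, hf₁⟩ : ∃ f₁, f₁ = y₁ - polar q y₁ f₀ • p₁ - polar q y₁ p₁ • f₀ := ⟨_, rfl⟩
  have h31 : polar q p₃ f₁ = 1 := by
    simp only [hf₁, polar_sub_right, polar_smul_right, polar_comm q p₃ p₁, polar_comm q p₃ f₀,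
      hp.h13, h01, hy₁]
    simp
  have h11 : polar q p₁ f₁ = 0 := by
    simp only [hf₁, polar_sub_right, polar_smul_right, polar_self_eq_zero, polar_comm q p₁ y₁, h00]
    simp
  have hf01 : polar q f₀ f₁ = 0 := by
    simp only [hf₁, polar_sub_right, polar_smul_right, polar_self_eq_zero, polar_comm q f₀ y₁,
      polar_comm q f₀ p₁, h00]
    simp
  obtain ⟨p₅, hp5, hp5'⟩ := exists_ne_zero_polar_eq_zero q ![p₁, f₀, p₃, f₁] (by rw [hdim]; simp)
  have h51 : polar q p₅ p₁ = 0 := hp5' 0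
  have h50 : polar q p₅ f₀ = 0 := hp5' 1
  have h53 : polar q p₅ p₃ = 0 := hp5' 2
  have h54 : polar q p₅ f₁ = 0 := hp5' 3
  obtain ⟨y₂, hy₂⟩ := hns.exists_polar_eq_one hp5
  obtain ⟨f₂, hf₂⟩ : ∃ f₂, f₂ = y₂ - polar q y₂ f₀ • p₁ - polar q y₂ p₁ • f₀ -
    polar q y₂ f₁ • p₃ - polar q y₂ p₃ • f₁ := ⟨_, rfl⟩
  have h52 : polar q p₅ f₂ = 1 := by
    simp only [hf₂, polar_sub_right, polar_smul_right, h51, h50, h53, h54, hy₂]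
    simp
  have h12 : polar q p₁ f₂ = 0 := by
    simp only [hf₂, polar_sub_right, polar_smul_right, polar_self_eq_zero, polar_comm q p₁ y₂, h00,
      hp.h13, h11]
    simp
  have h02 : polar q f₀ f₂ = 0 := by
    simp only [hf₂, polar_sub_right, polar_smul_right, polar_self_eq_zero, polar_comm q f₀ y₂,
      polar_comm q f₀ p₁, h00, h01, hf01]
    simp
  have h32 : polar q p₃ f₂ = 0 := by
    simp only [hf₂, polar_sub_right, polar_smul_right, polar_self_eq_zero, polar_comm q p₃ y₂,
      polar_comm q p₃ p₁, polar_comm q p₃ f₀, hp.h13, h01, h31]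
    simp
  have h42 : polar q f₁ f₂ = 0 := by
    simp only [hf₂, polar_sub_right, polar_smul_right, polar_self_eq_zero, polar_comm q f₁ y₂,
      polar_comm q f₁ p₁, polar_comm q f₁ f₀, polar_comm q f₁ p₃, h11, hf01, h31]
    simp
  have ht : q p₅ ≠ 0 := fun h0 => hp5 (han _ h0)
  refine ⟨q p₁, q p₅ / q p₁, q p₁ * h * q f₁, q p₅ * q f₂, ![p₁, p₃, p₅], ![f₀, f₁, f₂],
    ⟨fun i j => ?_, fun i j => ?_, fun i j => ?_⟩, hs, hp.hh, div_ne_zero ht hs, rfl, hqf₀, hp.h3,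
    rfl, (mul_div_cancel₀ _ hs).symm, ?_⟩
  · fin_cases i <;> fin_cases j <;>
      simp [-polar_self, polar_self_eq_zero, hp.h13, h51, h53, polar_comm q p₃ p₁,
        polar_comm q p₁ p₅, polar_comm q p₃ p₅]
  · fin_cases i <;> fin_cases j <;>
      simp [-polar_self, polar_self_eq_zero, hf01, h02, h42, polar_comm q f₁ f₀,
        polar_comm q f₂ f₀, polar_comm q f₂ f₁]
  · fin_cases i <;> fin_cases j <;>
      simp [h00, h11, h12, h31, h32, h50, h54, h52, h01, polar_comm q p₃ f₀]
  · change q p₁ * (q p₅ / q p₁) * q f₂ = _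
    rw [mul_div_cancel₀ _ hs]

/-- The complementary 2-fold Pfister form is isotropic as soon as the whole form is hyperbolic
and its first factor splits. -/
theorem AdaptedFamily.exists_isotropic (hA : AdaptedFamily q s h t u w r e f)
    (hdim : Module.finrank F V = 6) {l x y : F} (hl : u + w + r = l ^ 2 + l)
    (hxy : x ^ 2 + x * y + u * y ^ 2 = h) {L : Submodule F V} (hL : 6 ≤ 2 * Module.finrank F L)
    (hLq : ∀ m ∈ L, q m = 0) : ∃ z : Fin 4 → F, z ≠ 0 ∧ pf2 F (h * t) r z = 0 := by
  have hs := hA.hs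
  have hh := hA.hh
  have ht := hA.ht
  let X := x • e 0 + (y * s) • f 0 + e 1
  obtain ⟨m, hmL, hmX, hm⟩ : ∃ m ∈ L, polar q m X = 0 ∧ m ∉ Submodule.span F {X} := by
    by_contra! hno
    let g : L →ₗ[F] F := q.polarBilin.flip X ∘ₗ L.subtype
    have h1 := g.finrank_range_add_finrank_ker
    have h2 := (LinearMap.range g).finrank_le
    have h3 : Module.finrank F (LinearMap.ker g) ≤ Module.finrank F (Submodule.span F {X}) :=
      LinearMap.finrank_le_finrank_of_injective
        (f := (L.subtype ∘ₗ (LinearMap.ker g).subtype).codRestrict _ fun m => hno _ m.1.2 m.2)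
        fun m m' hmm => Subtype.ext (Subtype.ext (Subtype.ext_iff.1 hmm :))
    have h4 := finrank_span_le_card (R := F) ({X} : Set V)
    simp at h2 h4
    omega
  set c₁ := polar q m (f 0) with hc₁
  set c₂ := polar q m (e 0) / s with hc₂
  set c₃ := polar q m (f 1) with hc₃
  set c₄ := polar q m (e 1) / (s * h) with hc₄
  set c₅ := polar q m (f 2) with hc₅
  set c₆ := polar q m (e 2) / (s * t) with hc₆
  have hmc : m = c₁ • e 0 + (c₂ * s) • f 0 + (c₃ • e 1 + (c₄ * (s * h)) • f 1) +
      (c₅ • e 2 + (c₆ * (s * t)) • f 2) := by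
    conv_lhs => rw [hA.sympl.expand (by simpa using hdim) m, Fin.sum_univ_three]
    rw [hc₂, hc₄, hc₆, div_mul_cancel₀ _ hs, div_mul_cancel₀ _ (mul_ne_zero hs hh),
      div_mul_cancel₀ _ (mul_ne_zero hs ht)]
  have hq := hLq m hmL
  rw [hmc, hA.map_combination, mul_eq_zero, or_iff_right hs] at hq
  have horth : h * c₄ = c₁ * y + c₂ * x := by
    simp only [X, polar_add_right, polar_smul_right, smul_eq_mul] at hmX
    rw [← hc₁, show polar q m (e 0) = c₂ * s from (div_mul_cancel₀ _ hs).symm,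
      show polar q m (e 1) = c₄ * (s * h) from (div_mul_cancel₀ _ (mul_ne_zero hs hh)).symm] at hmX
    refine mul_left_cancel₀ hs ?_
    grind
  let G := (c₁ * (x + y) + u * c₂ * y) / h
  have hG : h * G = c₁ * (x + y) + u * c₂ * y := mul_div_cancel₀ _ hh
  have hG₁ : c₁ = G * x + u * c₄ * y := by
    refine mul_left_cancel₀ hh ?_
    grind
  have hG₂ : c₂ = G * y + c₄ * (x + y) := by
    refine mul_left_cancel₀ hh ?_
    grind
  refine ⟨![h * (G + c₃ + l * c₄), h * c₄, c₅, c₆], fun h0 => hm ?_, ?_⟩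
  · have z₀ : h * (G + c₃ + l * c₄) = 0 := congrFun h0 0
    have z₁ : c₄ = 0 := by simpa [hh] using congrFun h0 1
    have z₂ : c₅ = 0 := congrFun h0 2
    have z₃ : c₆ = 0 := congrFun h0 3
    have hGc : G = c₃ := by
      rw [z₁, mul_zero, add_zero, mul_eq_zero, or_iff_right hh] at z₀
      exact CharTwo.add_eq_zero.1 z₀
    rw [Submodule.mem_span_singleton]
    refine ⟨c₃, ?_⟩
    rw [hmc, hG₁, hG₂, z₁, z₂, z₃, hGc]
    simp only [X]
    module
  · rw [pf2_apply]
    simp only [Matrix.cons_val]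
    have hu : u = l ^ 2 + l + w + r := by grind
    grind

end AdaptedFamily

section WittDecomposition

variable {F : Type} [Field F]

theorem exists_qIsometric_of_hyperbolic_add {M : Type} [AddCommGroup M] [Module F M]
    [FiniteDimensional F M] {q : QuadraticForm F M} (hns : Nonsingular F q) {n i : ℕ} {φ : QF F n}
    (A B : Fin i → M →ₗ[F] F) (v : M →ₗ[F] (Fin n → F))
    (h : ∀ x, q x = ∑ k, A k x * B k x + φ (v x)) (hdim : Module.finrank F M = 2 * i + n) :
    ∃ i j : ℕ, QIsometric F q
      (oSum F (oSum F (oSumFam F fun _ : Fin i => binQF F 0 0) φ)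
        (diagQF F (0 : Fin j → F))) := by
  let g : M →ₗ[F] (Fin (i * 2 + n + 0) → F) := LinearMap.pi <|
    Fin.addCases (Fin.addCases
      (fun k => ![A (finProdFinEquiv.symm k).1, B (finProdFinEquiv.symm k).1]
        (finProdFinEquiv.symm k).2)
      (fun k => LinearMap.proj k ∘ₗ v)) Fin.elim0
  refine ⟨i, 0, qIsometric_of_map hns g (fun x => ?_) ?_⟩
  · rw [oSum_apply, oSum_apply, oSumFam_apply, diagQF_zero_apply, h, add_zero]
    simp only [binQF_apply]
    congr 1
    · refine Finset.sum_congr rfl fun k _ => ?_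
      simp only [g, LinearMap.pi_apply, Fin.addCases_left, Equiv.symm_apply_apply]
      simp
    · congr 1
      ext k
      simp only [g, LinearMap.pi_apply, Fin.addCases_left, Fin.addCases_right]
      rfl
  · rw [hdim, Module.finrank_fintype_fun_eq_card, Fintype.card_fin]
    ring

theorem Nonsingular.oSum {n m : ℕ} {q₁ : QF F n} {q₂ : QF F m} (h₁ : Nonsingular F q₁)
    (h₂ : Nonsingular F q₂) : Nonsingular F (_root_.oSum F q₁ q₂) := by
  intro x hx
  have hl : (fun i => x (Fin.castAdd m i)) = 0 := h₁ _ fun y => by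
    rw [← hx (Fin.append y 0)]
    simp [polar, oSum_apply, ← Pi.add_def]
    exact QuadraticMap.map_zero q₂
  have hr : (fun i => x (Fin.natAdd n i)) = 0 := h₂ _ fun y => by
    rw [← hx (Fin.append 0 y)]
    simp [polar, oSum_apply, ← Pi.add_def]
    exact QuadraticMap.map_zero q₁
  funext i
  refine Fin.addCases (fun k => ?_) (fun k => ?_) i
  · exact congrFun hl k
  · exact congrFun hr k

theorem Nonsingular.smul {M : Type} [AddCommGroup M] [Module F M] {q : QuadraticForm F M}
    (h : Nonsingular F q) {s : F} (hs : s ≠ 0) : Nonsingular F (s • q) := by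
  intro x hx
  refine h x fun y => ?_
  have := hx y
  rw [FunLike.coe_smul, QuadraticMap.polar_smul, smul_eq_mul] at this
  exact (mul_eq_zero.1 this).resolve_left hs

variable [CharP F 2]

theorem polar_oSumFam_binQF {k : ℕ} (c d : Fin k → F) (x y : Fin (k * 2) → F) :
    polar (oSumFam F fun i => binQF F (c i) (d i)) x y =
      ∑ i, (x (finProdFinEquiv (i, 0)) * y (finProdFinEquiv (i, 1)) +
        x (finProdFinEquiv (i, 1)) * y (finProdFinEquiv (i, 0))) := by
  simp only [polar, oSumFam_apply, binQF_apply, ← Finset.sum_sub_distrib, Pi.add_apply]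
  refine Finset.sum_congr rfl fun i _ => ?_
  grind

theorem exists_symplecticFamily_of_qIsometric {M : Type} [AddCommGroup M] [Module F M]
    {q : QuadraticForm F M} {k : ℕ} {c d : Fin k → F}
    (h : QIsometric F q (oSumFam F fun i => binQF F (c i) (d i))) :
    ∃ e f : Fin k → M, SymplecticFamily q e f ∧ arfSum q e f = ∑ i, c i * d i := by
  obtain ⟨g⟩ := h
  have hg (x y) : polar q (g.symm x) (g.symm y) =
      polar (oSumFam F fun i => binQF F (c i) (d i)) x y := by
    simp only [polar, ← map_add, QuadraticMap.IsometryEquiv.map_app]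
  refine ⟨fun i => g.symm (Pi.single (finProdFinEquiv (i, 0)) 1),
    fun i => g.symm (Pi.single (finProdFinEquiv (i, 1)) 1), ⟨fun i j => ?_, fun i j => ?_,
      fun i j => ?_⟩, ?_⟩
  · rw [hg, polar_oSumFam_binQF]
    simp [Pi.single_apply]
  · rw [hg, polar_oSumFam_binQF]
    simp [Pi.single_apply]
  · rw [hg, polar_oSumFam_binQF]
    simp [Pi.single_apply, eq_comm]
  · refine Finset.sum_congr rfl fun i _ => ?_
    simp only [QuadraticMap.IsometryEquiv.map_app, oSumFam_apply, binQF_apply]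
    simp [Pi.single_apply]

/-- A 6-dimensional form with trivial Arf invariant is Witt equivalent to a multiple of the sum of
two 2-fold Pfister forms. -/
theorem AdaptedFamily.wittEquiv {φ : QF F 6} {s h t u w r l : F} {e f : Fin 3 → Fin 6 → F}
    (hA : AdaptedFamily φ s h t u w r e f) (han : φ.Anisotropic) (hns : Nonsingular F φ)
    (hl : u + w + r = l ^ 2 + l) :
    WittEquiv F φ ((s * h) • oSum F (pf2 F h u) (pf2 F (h * t) r)) := by
  refine ⟨6, φ, han, ?_, ?_⟩
  · exact exists_qIsometric_of_hyperbolic_add hns (i := 0) (fun _ => 0) (fun _ => 0)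
      LinearMap.id (fun x => by simp) (by simp)
  · let p (i : Fin 8) : (Fin (4 + 4) → F) →ₗ[F] F := LinearMap.proj i
    have hns' := ((nonsingular_pf2 hA.hh (h := u)).oSum
      (nonsingular_pf2 (mul_ne_zero hA.hh hA.ht) (h := r))).smul (mul_ne_zero hA.hs hA.hh)
    refine exists_qIsometric_of_hyperbolic_add hns' (i := 1)
      (fun _ => (s * h) • (p 1 + p 5)) (fun _ => p 0 + u • (p 1 + p 5))
      ((h • p 2).smulRight (e 0) + ((h * s) • p 3).smulRight (f 0) +
        ((p 0 + p 4 + l • p 5).smulRight (e 1) + ((s * h) • p 5).smulRight (f 1)) +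
        ((h • p 6).smulRight (e 2) + ((h * (s * t)) • p 7).smulRight (f 2))) (fun x => ?_) ?_
    · have := hA.map_combination (h * x 2) (h * x 3) (x 0 + x 4 + l * x 5) (x 5) (h * x 6)
        (h * x 7)
      have hsum : ∀ y z : F, ∑ _k : Fin 1, y * z = y * z := fun y z => by simp
      rw [hsum]
      refine Eq.trans ?_ (congrArg₂ _ rfl (Eq.trans this.symm (congrArg φ ?_)))
      · rw [_root_.smul_apply, oSum_apply, pf2_apply, pf2_apply]
        simp [p]
        have hr : r = u + w + l ^ 2 + l := by grind
        subst hr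
        grind
      · ext k
        simp [p]
        ring
    · simp

end WittDecomposition

/-- for a simple quartic extension `E = F(α)` in characteristic 2 and an
anisotropic nonsingular 6-dimensional form `φ` with trivial Arf invariant and Witt class in
`W_q(E/F)`, there are 2-fold quadratic Pfister forms `π₁`, `π₂` of types (a'), (b), (c) and
`λ ∈ F*` with `φ = λ(π₁ + π₂)` in `W_qF`. -/
theorem stmt_9 (F : Type) [Field F] [CharP F 2] (E : Type) [Field E] [Algebra F E]
    (a b c d : F) (α : E)
    (hα : α ^ 4 + algebraMap F E a * α ^ 3 + algebraMap F E b * α ^ 2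
        + algebraMap F E c * α + algebraMap F E d = 0)
    (hdim : Module.finrank F E = 4)
    (hE : IntermediateField.adjoin F {α} = ⊤)
    (φ : QF F 6) (han : φ.Anisotropic) (hns : Nonsingular F φ)
    (harf : ∃ c' d' : Fin 3 → F, QIsometric F φ (oSumFam F fun i => binQF F (c' i) (d' i)) ∧
      ∃ lam : F, ∑ i, c' i * d' i = lam ^ 2 + lam)
    (hker : InWqKernel F E φ) :
    ∃ π₁ π₂ : QF F 4, IsKernelPf2 F E a b c d π₁ ∧ IsKernelPf2 F E a b c d π₂ ∧
      ∃ lam : F, lam ≠ 0 ∧ WittEquiv F φ (lam • oSum F π₁ π₂) := by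
  have hα' := QuarticRoot.of_adjoin hα hdim hE
  have := hα'.charP
  have hQ := extQF_coordMap (F := F) (E := E) φ
  obtain ⟨L, hL, hLQ⟩ := hker.exists_submodule
  obtain ⟨S, T, hST⟩ := hα'.exists_operators hQ han hL hLQ
  obtain ⟨u, h, p₁, p₂, p₃, hp⟩ := hα'.exists_splitTriple han hns (by simp) hST
  obtain ⟨s, t, w, r, e, f, hA⟩ := hp.exists_adaptedFamily han hns (by simp)
  obtain ⟨c', d', hφ, lam, hlam⟩ := harf
  obtain ⟨e', f', hef, harf'⟩ := exists_symplecticFamily_of_qIsometric hφ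
  obtain ⟨l, hl⟩ := arfSum_congr hef hA.sympl (by simp)
  have harfA : u + w + r = (lam + l) ^ 2 + (lam + l) := by
    rw [← hA.arfSum_eq, hl, harf', hlam, CharTwo.add_sq]
    ring
  obtain ⟨x, y, hxy⟩ := hp.split
  obtain ⟨π₁, hπ₁, hi₁⟩ := hα'.exists_isKernelPf2 hA.hh (u := u) (z := ![x, y, 1, 0])
    (fun hz => one_ne_zero (congrFun hz 2)) (by
      rw [pf2_apply]
      simp [hxy, CharTwo.add_self_eq_zero])
  obtain ⟨z, hz0, hz⟩ := (hA.coordMap_family hQ).exists_isotropic (by simp)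
    (l := algebraMap F E (lam + l)) (by simpa using congrArg (algebraMap F E) harfA) hxy
    (by simpa using hL) hLQ
  obtain ⟨π₂, hπ₂, hi₂⟩ := hα'.exists_isKernelPf2 (mul_ne_zero hA.hh hA.ht) (u := r) hz0
    (by rwa [map_mul])
  obtain ⟨n, ρ, hρ, h₁, i, j, h₂⟩ := hA.wittEquiv han hns harfA
  exact ⟨π₁, π₂, hπ₁, hπ₂, s * h, mul_ne_zero hA.hs hA.hh, n, ρ, hρ, h₁, i, j,
    (smul_congr _ (oSum_congr hi₁ hi₂)).symm.trans h₂⟩
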